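/- arXiv:0705.4363 — 14 statements merged into one kernel-verified Lean document; each statement's English description precedes it below -/
import Mathlib

section
/- Let n ≥ 1, let ε₁,…,εₙ be real constants, and let u, b₁,…,bₙ, c₁,…,cₙ : ℝ → ℂ be differentiable functions satisfying the restricted multiple three-wave interaction system i·bⱼ' + u·cⱼ − (εⱼ/2)·bⱼ = 0, i·cⱼ' + conj(u)·bⱼ + (εⱼ/2)·cⱼ = 0 (j = 1,…,n), and i·u' + Σⱼ bⱼ·conj(cⱼ) = 0. Then for every λ ∈ ℂ with λ ≠ εⱼ for all j, the 2×2 matrices L(ξ,λ) with entries L₁₁ = a(λ)(−iλ/2 + (i/2)Σⱼ (|cⱼ|² − |bⱼ|²)/(λ−εⱼ)), L₁₂ = a(λ)(iu − iΣⱼ bⱼ·conj(cⱼ)/(λ−εⱼ)), L₂₁ = a(λ)(i·conj(u) − iΣⱼ cⱼ·conj(bⱼ)/(λ−εⱼ)), L₂₂ = −L₁₁, where a(λ) = ∏ⱼ (λ−εⱼ), and M(ξ,λ) = [[−iλ/2, i·u],[i·conj(u), iλ/2]] satisfy the Lax equation dL/dξ = M·L − L·M. -/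
open Complex Matrix

/-- The Lax representation of the restricted multiple three wave
interaction system. If `u, b j, c j` solve the system, then the matrices
`L(ξ,λ)` and `M(ξ,λ)` defined below satisfy `dL/dξ = M·L − L·M`. -/
theorem lax_pair_restricted_multiple_three_wave
    (n : ℕ) (hn : 1 ≤ n) (ε : Fin n → ℝ)
    (u : ℝ → ℂ) (b c : Fin n → ℝ → ℂ)
    (hu : Differentiable ℝ u)
    (hb : ∀ j, Differentiable ℝ (b j))
    (hc : ∀ j, Differentiable ℝ (c j))
    (eqb : ∀ j ξ, I * deriv (b j) ξ + u ξ * c j ξ - (ε j : ℂ) / 2 * b j ξ = 0)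
    (eqc : ∀ j ξ, I * deriv (c j) ξ + star (u ξ) * b j ξ + (ε j : ℂ) / 2 * c j ξ = 0)
    (equ : ∀ ξ, I * deriv u ξ + ∑ j, b j ξ * star (c j ξ) = 0)
    (lam : ℂ) (hlam : ∀ j, lam ≠ (ε j : ℂ)) :
    let a : ℂ := ∏ j, (lam - (ε j : ℂ))
    let A : ℝ → ℂ := fun ξ => a * (-I * lam / 2
      + I / 2 * ∑ j, (c j ξ * star (c j ξ) - b j ξ * star (b j ξ)) / (lam - (ε j : ℂ)))
    let B : ℝ → ℂ := fun ξ => a * (I * u ξ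
      - I * ∑ j, b j ξ * star (c j ξ) / (lam - (ε j : ℂ)))
    let C : ℝ → ℂ := fun ξ => a * (I * star (u ξ)
      - I * ∑ j, c j ξ * star (b j ξ) / (lam - (ε j : ℂ)))
    let L : ℝ → Matrix (Fin 2) (Fin 2) ℂ := fun ξ => !![A ξ, B ξ; C ξ, -A ξ]
    let M : ℝ → Matrix (Fin 2) (Fin 2) ℂ := fun ξ =>
      !![-I * lam / 2, I * u ξ; I * star (u ξ), I * lam / 2]
    ∀ ξ : ℝ, ∀ i k : Fin 2,
      HasDerivAt (fun t => L t i k) ((M ξ * L ξ - L ξ * M ξ) i k) ξ := by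
  intro a A B C L M ξ
  have dB : ∀ j, HasDerivAt (b j) (I * u ξ * c j ξ - I * (ε j : ℂ) / 2 * b j ξ) ξ := by
    intro j
    have h := (hb j ξ).hasDerivAt
    refine h.congr_deriv ?_
    linear_combination (-I) * eqb j ξ + deriv (b j) ξ * I_mul_I
  have dC : ∀ j, HasDerivAt (c j) (I * star (u ξ) * b j ξ + I * (ε j : ℂ) / 2 * c j ξ) ξ := by
    intro j
    have h := (hc j ξ).hasDerivAt
    refine h.congr_deriv ?_
    linear_combination (-I) * eqc j ξ + deriv (c j) ξ * I_mul_I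
  have dU : HasDerivAt u (I * ∑ j, b j ξ * star (c j ξ)) ξ := by
    have h := (hu ξ).hasDerivAt
    refine h.congr_deriv ?_
    linear_combination (-I) * equ ξ + deriv u ξ * I_mul_I
  have dBs : ∀ j, HasDerivAt (fun t => star (b j t))
      (-I * star (u ξ) * star (c j ξ) + I * (ε j : ℂ) / 2 * star (b j ξ)) ξ := by
    intro j
    refine (dB j).star.congr_deriv ?_
    simp
    ring
  have dCs : ∀ j, HasDerivAt (fun t => star (c j t))
      (-I * u ξ * star (b j ξ) - I * (ε j : ℂ) / 2 * star (c j ξ)) ξ := by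
    intro j
    refine (dC j).star.congr_deriv ?_
    simp
    ring
  have dUs : HasDerivAt (fun t => star (u t)) (-I * ∑ j, c j ξ * star (b j ξ)) ξ := by
    refine dU.star.congr_deriv ?_
    simp [mul_comm]
  have hne : ∀ j, lam - (ε j : ℂ) ≠ 0 := fun j => sub_ne_zero.mpr (hlam j)
  have I2 : I ^ 2 = -1 := I_sq
  have hA : HasDerivAt A (I * u ξ * C ξ - B ξ * (I * star (u ξ))) ξ := by
    have h := ((HasDerivAt.fun_sum (u := Finset.univ) fun j _ =>
      ((((dC j).mul (dCs j)).sub ((dB j).mul (dBs j))).div_const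
        (lam - (ε j : ℂ)))).const_mul (I / 2)).const_add (-I * lam / 2) |>.const_mul a
    refine h.congr_deriv ?_
    have e : ∀ x y : ℂ, ∀ f g : Fin n → ℂ, I * x * (a * (I * y - I * ∑ j, f j))
        - (a * (I * x - I * ∑ j, g j)) * (I * y) = a * ∑ j, (x * f j - y * g j) := by
      intro x y f g
      rw [Finset.sum_sub_distrib, ← Finset.mul_sum, ← Finset.mul_sum]
      linear_combination (a * y * ∑ j, g j - a * x * ∑ j, f j) * I2
    simp only [B, C]
    rw [e, Finset.mul_sum]
    congr 1
    refine Finset.sum_congr rfl fun j _ => ?_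
    have := hne j
    field_simp
    ring_nf
    simp only [I2]
    ring
  have hB : HasDerivAt B (-I * lam * B ξ - 2 * I * u ξ * A ξ) ξ := by
    have h := ((dU.const_mul I).sub ((HasDerivAt.fun_sum (u := Finset.univ) fun j _ =>
      (((dB j).mul (dCs j)).div_const (lam - (ε j : ℂ)))).const_mul I)).const_mul a
    refine h.congr_deriv ?_
    have e : ∀ x : ℂ, ∀ f g : Fin n → ℂ, -I * lam * (a * (I * x - I * ∑ j, f j))
        - 2 * I * x * (a * (-I * lam / 2 + I / 2 * ∑ j, g j))
        = a * ∑ j, (x * g j - lam * f j) := by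
      intro x f g
      rw [Finset.sum_sub_distrib, ← Finset.mul_sum, ← Finset.mul_sum]
      linear_combination (a * lam * ∑ j, f j - a * x * ∑ j, g j) * I2
    simp only [A, B]
    rw [e, Finset.mul_sum, Finset.mul_sum, Finset.mul_sum, ← Finset.sum_sub_distrib]
    congr 1
    refine Finset.sum_congr rfl fun j _ => ?_
    have := hne j
    field_simp
    ring_nf
    simp only [I2]
    ring
  have hC : HasDerivAt C (I * lam * C ξ + 2 * I * star (u ξ) * A ξ) ξ := by
    have h := ((dUs.const_mul I).sub ((HasDerivAt.fun_sum (u := Finset.univ) fun j _ =>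
      (((dC j).mul (dBs j)).div_const (lam - (ε j : ℂ)))).const_mul I)).const_mul a
    refine h.congr_deriv ?_
    have e : ∀ x : ℂ, ∀ f g : Fin n → ℂ, I * lam * (a * (I * x - I * ∑ j, f j))
        + 2 * I * x * (a * (-I * lam / 2 + I / 2 * ∑ j, g j))
        = a * ∑ j, (lam * f j - x * g j) := by
      intro x f g
      rw [Finset.sum_sub_distrib, ← Finset.mul_sum, ← Finset.mul_sum]
      linear_combination (-a * lam * ∑ j, f j + a * x * ∑ j, g j) * I2
    simp only [A, C]
    rw [e, Finset.mul_sum, Finset.mul_sum, Finset.mul_sum, ← Finset.sum_sub_distrib]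
    congr 1
    refine Finset.sum_congr rfl fun j _ => ?_
    have := hne j
    field_simp
    ring_nf
    simp only [I2]
    ring
  clear_value A B C
  intro i k
  fin_cases i <;> fin_cases k
  · refine hA.congr_deriv ?_
    simp [L, M, Matrix.mul_apply, Fin.sum_univ_two]
    ring
  · refine hB.congr_deriv ?_
    simp [L, M, Matrix.mul_apply, Fin.sum_univ_two]
    ring
  · refine hC.congr_deriv ?_
    simp [L, M, Matrix.mul_apply, Fin.sum_univ_two]
    ring
  · refine hA.neg.congr_deriv ?_
    simp [L, M, Matrix.mul_apply, Fin.sum_univ_two]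
    ring
end

section
/- Let n ≥ 1, let ε₁,…,εₙ be real constants, and let u, b₁,…,bₙ, c₁,…,cₙ : ℝ → ℂ be differentiable functions satisfying the restricted multiple three-wave interaction system i·bⱼ' + u·cⱼ − (εⱼ/2)·bⱼ = 0, i·cⱼ' + conj(u)·bⱼ + (εⱼ/2)·cⱼ = 0, i·u' + Σⱼ bⱼ·conj(cⱼ) = 0. Then the quantity J₀ = i|u|² + (i/2)·Σⱼ₌₁ⁿ (|bⱼ|² − |cⱼ|²) is constant in ξ. -/
open Complex

/-- For solutions of the restricted multiple three wave interaction
system, the quantity `J₀ = i|u|² + (i/2)·Σⱼ (|bⱼ|² − |cⱼ|²)` is conserved. -/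
theorem J0_is_conserved
    (n : ℕ) (hn : 1 ≤ n) (ε : Fin n → ℝ)
    (u : ℝ → ℂ) (b c : Fin n → ℝ → ℂ)
    (hu : Differentiable ℝ u)
    (hb : ∀ j, Differentiable ℝ (b j))
    (hc : ∀ j, Differentiable ℝ (c j))
    (eqb : ∀ j ξ, I * deriv (b j) ξ + u ξ * c j ξ - (ε j : ℂ) / 2 * b j ξ = 0)
    (eqc : ∀ j ξ, I * deriv (c j) ξ + star (u ξ) * b j ξ + (ε j : ℂ) / 2 * c j ξ = 0)
    (equ : ∀ ξ, I * deriv u ξ + ∑ j, b j ξ * star (c j ξ) = 0) :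
    let J₀ : ℝ → ℂ := fun ξ => I * (u ξ * star (u ξ))
      + I / 2 * ∑ j, (b j ξ * star (b j ξ) - c j ξ * star (c j ξ))
    ∀ ξ₁ ξ₂ : ℝ, J₀ ξ₁ = J₀ ξ₂ := by
  intro J₀
  have du : ∀ ξ, deriv u ξ = I * ∑ j, b j ξ * star (c j ξ) := fun ξ => by
    linear_combination (-I) * equ ξ + deriv u ξ * I_mul_I
  have db : ∀ j ξ, deriv (b j) ξ = I * (u ξ * c j ξ - (ε j : ℂ) / 2 * b j ξ) := fun j ξ => by
    linear_combination (-I) * eqb j ξ + deriv (b j) ξ * I_mul_I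
  have dc : ∀ j ξ, deriv (c j) ξ = I * (star (u ξ) * b j ξ + (ε j : ℂ) / 2 * c j ξ) :=
    fun j ξ => by
    linear_combination (-I) * eqc j ξ + deriv (c j) ξ * I_mul_I
  have key : ∀ ξ, HasDerivAt J₀ 0 ξ := by
    intro ξ
    have h1 := (hu ξ).hasDerivAt
    have h2 := h1.mul h1.star
    have h3 : ∀ j ∈ (Finset.univ : Finset (Fin n)), HasDerivAt
        (fun ξ => b j ξ * star (b j ξ) - c j ξ * star (c j ξ)) _ ξ := fun j _ =>
      (((hb j ξ).hasDerivAt).mul ((hb j ξ).hasDerivAt).star).sub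
      (((hc j ξ).hasDerivAt).mul ((hc j ξ).hasDerivAt).star)
    have h4 := (h2.const_mul I).add ((HasDerivAt.fun_sum h3).const_mul (I / 2))
    refine h4.congr_deriv ?_
    simp only [du, db, dc]
    have e : star (I * ∑ j, b j ξ * star (c j ξ)) = -I * ∑ j, star (b j ξ) * c j ξ := by
      simp
    rw [e]
    simp only [Finset.mul_sum, Finset.sum_mul]
    rw [← Finset.sum_add_distrib, Finset.mul_sum, ← Finset.sum_add_distrib]
    apply Finset.sum_eq_zero
    intro j _
    simp
    ring
  intro x y
  exact is_const_of_deriv_eq_zero (fun ξ => (key ξ).differentiableAt) (fun ξ => (key ξ).deriv) x y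
end

section
/- Let n ≥ 1, let ε₁,…,εₙ be pairwise distinct real constants, and let u, b₁,…,bₙ, c₁,…,cₙ : ℝ → ℂ be differentiable functions satisfying the restricted multiple three-wave interaction system i·bⱼ' + u·cⱼ − (εⱼ/2)·bⱼ = 0, i·cⱼ' + conj(u)·bⱼ + (εⱼ/2)·cⱼ = 0, i·u' + Σⱼ bⱼ·conj(cⱼ) = 0. Then for each j = 1,…,n the quantity Kⱼ = i·u·conj(bⱼ)·cⱼ + i·conj(u)·bⱼ·conj(cⱼ) + i(εⱼ/2)(|cⱼ|² − |bⱼ|²) − (i/2)·Σ_{k≠j} [ (|bⱼ|² − |cⱼ|²)(|b_k|² − |c_k|²) + 2·conj(bⱼ)·cⱼ·b_k·conj(c_k) + 2·bⱼ·conj(cⱼ)·conj(b_k)·c_k ] / (εⱼ − ε_k) is constant in ξ. -/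
open Complex

/-- For solutions of the restricted multiple three wave interaction
system with pairwise distinct mismatches `εⱼ`, each quantity `Kⱼ` is conserved. -/
theorem Kj_is_conserved
    (n : ℕ) (hn : 1 ≤ n) (ε : Fin n → ℝ) (hε : Function.Injective ε)
    (u : ℝ → ℂ) (b c : Fin n → ℝ → ℂ)
    (hu : Differentiable ℝ u)
    (hb : ∀ j, Differentiable ℝ (b j))
    (hc : ∀ j, Differentiable ℝ (c j))
    (eqb : ∀ j ξ, I * deriv (b j) ξ + u ξ * c j ξ - (ε j : ℂ) / 2 * b j ξ = 0)
    (eqc : ∀ j ξ, I * deriv (c j) ξ + star (u ξ) * b j ξ + (ε j : ℂ) / 2 * c j ξ = 0)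
    (equ : ∀ ξ, I * deriv u ξ + ∑ j, b j ξ * star (c j ξ) = 0) :
    let K : Fin n → ℝ → ℂ := fun j ξ =>
      I * u ξ * star (b j ξ) * c j ξ + I * star (u ξ) * b j ξ * star (c j ξ)
      + I * ((ε j : ℂ) / 2) * (c j ξ * star (c j ξ) - b j ξ * star (b j ξ))
      - I / 2 * ∑ k ∈ Finset.univ.erase j,
          ((b j ξ * star (b j ξ) - c j ξ * star (c j ξ))
              * (b k ξ * star (b k ξ) - c k ξ * star (c k ξ))
            + 2 * star (b j ξ) * c j ξ * b k ξ * star (c k ξ)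
            + 2 * b j ξ * star (c j ξ) * star (b k ξ) * c k ξ)
            / ((ε j : ℂ) - (ε k : ℂ))
    ∀ j : Fin n, ∀ ξ₁ ξ₂ : ℝ, K j ξ₁ = K j ξ₂ := by
  intro K j
  have db : ∀ k ξ, HasDerivAt (b k) (I * (u ξ * c k ξ - (ε k : ℂ) / 2 * b k ξ)) ξ := by
    intro k ξ
    have h := (hb k ξ).hasDerivAt
    have e : deriv (b k) ξ = I * (u ξ * c k ξ - (ε k : ℂ) / 2 * b k ξ) := by
      linear_combination (-I) * eqb k ξ + deriv (b k) ξ * I_mul_I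
    rwa [e] at h
  have dc : ∀ k ξ, HasDerivAt (c k) (I * (star (u ξ) * b k ξ + (ε k : ℂ) / 2 * c k ξ)) ξ := by
    intro k ξ
    have h := (hc k ξ).hasDerivAt
    have e : deriv (c k) ξ = I * (star (u ξ) * b k ξ + (ε k : ℂ) / 2 * c k ξ) := by
      linear_combination (-I) * eqc k ξ + deriv (c k) ξ * I_mul_I
    rwa [e] at h
  have du : ∀ ξ, HasDerivAt u (I * ∑ k, b k ξ * star (c k ξ)) ξ := by
    intro ξ
    have h := (hu ξ).hasDerivAt
    have e : deriv u ξ = I * ∑ k, b k ξ * star (c k ξ) := by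
      linear_combination (-I) * equ ξ + deriv u ξ * I_mul_I
    rwa [e] at h
  have sI : star I = -I := conj_I
  have sε : ∀ k, star ((ε k : ℂ)) = ε k := fun k => conj_ofReal _
  have s2 : star (2 : ℂ) = 2 := by simp
  have dbs : ∀ k ξ, HasDerivAt (fun x => star (b k x))
      (-I * (star (u ξ) * star (c k ξ) - (ε k : ℂ) / 2 * star (b k ξ))) ξ := by
    intro k ξ
    refine (db k ξ).star.congr_deriv ?_
    simp only [star_mul', star_sub, star_div₀, sI, sε, s2]
  have dcs : ∀ k ξ, HasDerivAt (fun x => star (c k x))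
      (-I * (u ξ * star (b k ξ) + (ε k : ℂ) / 2 * star (c k ξ))) ξ := by
    intro k ξ
    refine (dc k ξ).star.congr_deriv ?_
    simp only [star_mul', star_add, star_div₀, sI, sε, s2, star_star]
  have dus : ∀ ξ, HasDerivAt (fun x => star (u x)) (-I * ∑ k, star (b k ξ) * c k ξ) ξ := by
    intro ξ
    refine (du ξ).star.congr_deriv ?_
    simp only [star_mul', star_sum, sI, star_star]
  have dP : ∀ k ξ, HasDerivAt (fun x => b k x * star (c k x))
      (-I * u ξ * (b k ξ * star (b k ξ) - c k ξ * star (c k ξ))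
        - I * ε k * (b k ξ * star (c k ξ))) ξ := by
    intro k ξ
    refine ((db k ξ).mul (dcs k ξ)).congr_deriv ?_
    ring
  have dQ : ∀ k ξ, HasDerivAt (fun x => star (b k x) * c k x)
      (I * star (u ξ) * (b k ξ * star (b k ξ) - c k ξ * star (c k ξ))
        + I * ε k * (star (b k ξ) * c k ξ)) ξ := by
    intro k ξ
    refine ((dbs k ξ).mul (dc k ξ)).congr_deriv ?_
    ring
  have dA : ∀ k ξ, HasDerivAt (fun x => b k x * star (b k x) - c k x * star (c k x))
      (2 * I * (u ξ * (star (b k ξ) * c k ξ) - star (u ξ) * (b k ξ * star (c k ξ)))) ξ := by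
    intro k ξ
    refine (((db k ξ).mul (dbs k ξ)).sub ((dc k ξ).mul (dcs k ξ))).congr_deriv ?_
    ring
  have dT : ∀ k ∈ Finset.univ.erase j, ∀ ξ, HasDerivAt (fun ξ =>
          ((b j ξ * star (b j ξ) - c j ξ * star (c j ξ))
              * (b k ξ * star (b k ξ) - c k ξ * star (c k ξ))
            + 2 * star (b j ξ) * c j ξ * b k ξ * star (c k ξ)
            + 2 * b j ξ * star (c j ξ) * star (b k ξ) * c k ξ)
            / ((ε j : ℂ) - (ε k : ℂ)))
      (2 * I * ((star (b j ξ) * c j ξ) * (b k ξ * star (c k ξ))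
        - (b j ξ * star (c j ξ)) * (star (b k ξ) * c k ξ))) ξ := by
    intro k hk ξ
    have hne : (ε j : ℂ) - (ε k : ℂ) ≠ 0 := by
      rw [sub_ne_zero]
      intro h
      exact (Finset.ne_of_mem_erase hk) (hε (ofReal_injective h)).symm
    have h := (((dA j ξ).mul (dA k ξ)).add
      ((((dQ j ξ).mul (dP k ξ)).const_mul 2).add
        (((dP j ξ).mul (dQ k ξ)).const_mul 2))).div_const ((ε j : ℂ) - (ε k : ℂ))
    refine (h.congr_deriv ?_).congr_of_eventuallyEq (Filter.Eventually.of_forall fun x => ?_)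
    · rw [div_eq_iff hne]
      ring
    · simp only [Pi.add_apply, Pi.mul_apply]
      ring
  have dK : ∀ ξ, HasDerivAt (K j) 0 ξ := by
    intro ξ
    have hS := HasDerivAt.fun_sum (fun k hk => dT k hk ξ)
    have h := ((((du ξ).mul (dQ j ξ)).add ((dus ξ).mul (dP j ξ))).const_mul I).sub
      ((dA j ξ).const_mul (I * ((ε j : ℂ) / 2))) |>.sub (hS.const_mul (I / 2))
    refine (h.congr_deriv ?_).congr_of_eventuallyEq (Filter.Eventually.of_forall fun x => ?_)
    · rw [← Finset.mul_sum, Finset.sum_sub_distrib, ← Finset.mul_sum, ← Finset.mul_sum,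
        ← Finset.add_sum_erase _ _ (Finset.mem_univ j),
        ← Finset.add_sum_erase _ (fun k => star (b k ξ) * c k ξ) (Finset.mem_univ j)]
      ring
    · simp only [K, Pi.add_apply, Pi.mul_apply, Pi.sub_apply]
      ring
  exact is_const_of_deriv_eq_zero (fun ξ => (dK ξ).differentiableAt) (fun ξ => (dK ξ).deriv)
end

section
/- Let n ≥ 1, let ε₁,…,εₙ be pairwise distinct real numbers, let u, b₁,…,bₙ, c₁,…,cₙ ∈ ℂ, and let λ ∈ ℂ with λ ≠ εⱼ for all j. Define a(λ) = ∏ⱼ (λ−εⱼ), A = a(λ)(−iλ/2 + (i/2)Σⱼ (|cⱼ|² − |bⱼ|²)/(λ−εⱼ)), B = a(λ)(iu − iΣⱼ bⱼ·conj(cⱼ)/(λ−εⱼ)), C = a(λ)(i·conj(u) − iΣⱼ cⱼ·conj(bⱼ)/(λ−εⱼ)). Then A² + B·C = a(λ)²·( −λ²/4 + i·J₀ − i·Σⱼ Kⱼ/(λ−εⱼ) + (1/4)·Σⱼ Jⱼ²/(λ−εⱼ)² ), where J₀ = i|u|² + (i/2)Σⱼ (|bⱼ|² − |cⱼ|²),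 Jⱼ = i(|bⱼ|² + |cⱼ|²), and Kⱼ = i·u·conj(bⱼ)·cⱼ + i·conj(u)·bⱼ·conj(cⱼ) + i(εⱼ/2)(|cⱼ|² − |bⱼ|²) − (i/2)·Σ_{k≠j} [ (|bⱼ|² − |cⱼ|²)(|b_k|² − |c_k|²) + 2·conj(bⱼ)·cⱼ·b_k·conj(c_k) + 2·bⱼ·conj(cⱼ)·conj(b_k)·c_k ] / (εⱼ − ε_k). -/
open Complex

lemma sc_aux (n : ℕ) (e x : Fin n → ℂ) (l : ℂ) (he : Function.Injective e)
    (hl : ∀ j, l - e j ≠ 0) (hx : ∀ j, x j = (l - e j)⁻¹) (M : Fin n → Fin n → ℂ)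
    (hM : ∀ j k, M j k = M k j) :
    ∑ j, ∑ k, M j k * x j * x k
      = 2 * ∑ j, (∑ k ∈ Finset.univ.erase j, M j k / (e j - e k)) * x j
        + ∑ j, M j j * x j ^ 2 := by
  have h1 : ∀ j, ∑ k ∈ Finset.univ.erase j, M j k / (e j - e k)
      = ∑ k, M j k / (e j - e k) := by
    intro j
    apply Finset.sum_erase
    simp
  have h2 : ∀ j k, M j k * x j * x k = M j k / (e j - e k) * x j + M k j / (e k - e j) * x k
      + if j = k then M j j * x j ^ 2 else 0 := by
    intro j k
    by_cases h : j = k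
    · subst h
      simp
      ring
    · have h3 : e j - e k ≠ 0 := sub_ne_zero.mpr (fun h' => h (he h'))
      have h4 : e k - e j ≠ 0 := sub_ne_zero.mpr (fun h' => h (he h').symm)
      have h5 : M k j / (e k - e j) = - (M j k / (e j - e k)) := by
        rw [hM k j, ← neg_sub (e j) (e k), div_neg]
      have h6 : x j - x k = (e j - e k) * (x j * x k) := by
        rw [hx, hx]
        have := hl j
        have := hl k
        field_simp
        ring
      rw [if_neg h, h5]
      have h7 : M j k / (e j - e k) * x j + -(M j k / (e j - e k)) * x k + 0
        = M j k / (e j - e k) * (x j - x k) := by ring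
      rw [h7, h6]
      field_simp
  simp_rw [h1, h2, Finset.sum_add_distrib]
  rw [Finset.sum_comm (f := fun j k => M k j / (e k - e j) * x k)]
  simp only [Finset.sum_ite_eq, Finset.mem_univ, if_true, Finset.sum_mul]
  ring

/-- The spectral curve identity. For the Lax matrix entries `A, B, C`
of the restricted multiple three wave interaction system (at a point of phase space),
`A² + BC` is expressed through the integrals of motion `J₀, Jⱼ, Kⱼ`. -/
theorem spectral_curve_identity
    (n : ℕ) (hn : 1 ≤ n) (ε : Fin n → ℝ) (hε : Function.Injective ε)
    (u : ℂ) (b c : Fin n → ℂ)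
    (lam : ℂ) (hlam : ∀ j, lam ≠ (ε j : ℂ)) :
    let a : ℂ := ∏ j, (lam - (ε j : ℂ))
    let A : ℂ := a * (-I * lam / 2
      + I / 2 * ∑ j, (c j * star (c j) - b j * star (b j)) / (lam - (ε j : ℂ)))
    let B : ℂ := a * (I * u - I * ∑ j, b j * star (c j) / (lam - (ε j : ℂ)))
    let C : ℂ := a * (I * star u - I * ∑ j, c j * star (b j) / (lam - (ε j : ℂ)))
    let J₀ : ℂ := I * (u * star u) + I / 2 * ∑ j, (b j * star (b j) - c j * star (c j))
    let J : Fin n → ℂ := fun j => I * (b j * star (b j) + c j * star (c j))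
    let K : Fin n → ℂ := fun j =>
      I * u * star (b j) * c j + I * star u * b j * star (c j)
      + I * ((ε j : ℂ) / 2) * (c j * star (c j) - b j * star (b j))
      - I / 2 * ∑ k ∈ Finset.univ.erase j,
          ((b j * star (b j) - c j * star (c j)) * (b k * star (b k) - c k * star (c k))
            + 2 * star (b j) * c j * b k * star (c k)
            + 2 * b j * star (c j) * star (b k) * c k)
            / ((ε j : ℂ) - (ε k : ℂ))
    A ^ 2 + B * C = a ^ 2 * (-lam ^ 2 / 4 + I * J₀
      - I * ∑ j, K j / (lam - (ε j : ℂ))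
      + (1 / 4) * ∑ j, (J j) ^ 2 / (lam - (ε j : ℂ)) ^ 2) := by
  intro a A B C J₀ J K
  obtain ⟨x, hx⟩ : ∃ x : Fin n → ℂ, ∀ j, x j = (lam - (ε j : ℂ))⁻¹ := ⟨_, fun _ => rfl⟩
  have hl : ∀ j, lam - (ε j : ℂ) ≠ 0 := fun j => sub_ne_zero.mpr (hlam j)
  have hlx : ∀ j, lam * x j = 1 + (ε j : ℂ) * x j := by
    intro j
    have := mul_inv_cancel₀ (hl j)
    rw [← hx] at this
    linear_combination this
  have key := sc_aux n (fun j => (ε j : ℂ)) x lam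
    (fun i j h => hε (Complex.ofReal_injective h)) hl hx
    (fun j k => (b j * star (b j) - c j * star (c j)) * (b k * star (b k) - c k * star (c k))
            + 2 * star (b j) * c j * b k * star (c k)
            + 2 * b j * star (c j) * star (b k) * c k) (fun j k => by ring)
  have hK : ∑ j, K j / (lam - (ε j : ℂ)) = I * u * (∑ j, c j * star (b j) * x j)
      + I * star u * (∑ j, b j * star (c j) * x j)
      + I / 2 * (lam * ∑ j, (c j * star (c j) - b j * star (b j)) * x j
        - ∑ j, (c j * star (c j) - b j * star (b j)))
      - I / 2 * ∑ j, (∑ k ∈ Finset.univ.erase j,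
          ((b j * star (b j) - c j * star (c j)) * (b k * star (b k) - c k * star (c k))
            + 2 * star (b j) * c j * b k * star (c k)
            + 2 * b j * star (c j) * star (b k) * c k)
            / ((ε j : ℂ) - (ε k : ℂ))) * x j := by
    simp only [Finset.mul_sum (s := (Finset.univ : Finset (Fin n)))]
    rw [← Finset.sum_sub_distrib, Finset.mul_sum, ← Finset.sum_add_distrib,
      ← Finset.sum_add_distrib, ← Finset.sum_sub_distrib]
    refine Finset.sum_congr rfl fun j _ => ?_
    rw [div_eq_mul_inv, ← hx]
    simp only [K]
    linear_combination (-I / 2 * (c j * star (c j) - b j * star (b j))) * hlx j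
  have hM : ∑ j, ∑ k, ((b j * star (b j) - c j * star (c j))
              * (b k * star (b k) - c k * star (c k))
            + 2 * star (b j) * c j * b k * star (c k)
            + 2 * b j * star (c j) * star (b k) * c k) * x j * x k
      = (∑ j, (c j * star (c j) - b j * star (b j)) * x j) ^ 2
        + 4 * ((∑ j, b j * star (c j) * x j) * (∑ j, c j * star (b j) * x j)) := by
    have e1 : (4 : ℂ) * ((∑ j, b j * star (c j) * x j) * (∑ j, c j * star (b j) * x j))
      = 2 * ((∑ j, b j * star (c j) * x j) * (∑ j, c j * star (b j) * x j))
       + 2 * ((∑ j, c j * star (b j) * x j) * (∑ j, b j * star (c j) * x j)) := by ring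
    rw [e1, sq]
    simp only [Finset.sum_mul_sum]
    simp only [Finset.mul_sum, ← Finset.sum_add_distrib]
    refine Finset.sum_congr rfl fun j _ => Finset.sum_congr rfl fun k _ => ?_
    ring
  have hJ : ∑ j, (J j) ^ 2 / (lam - (ε j : ℂ)) ^ 2 = - ∑ j,
      ((b j * star (b j) - c j * star (c j)) * (b j * star (b j) - c j * star (c j))
            + 2 * star (b j) * c j * b j * star (c j)
            + 2 * b j * star (c j) * star (b j) * c j) * x j ^ 2 := by
    rw [← Finset.sum_neg_distrib]
    refine Finset.sum_congr rfl fun j _ => ?_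
    rw [div_eq_mul_inv, ← inv_pow, ← hx]
    simp only [J]
    linear_combination ((b j * star (b j) + c j * star (c j)) ^ 2 * x j ^ 2) * I_sq
  have hJ0 : ∑ j, (b j * star (b j) - c j * star (c j))
      = - ∑ j, (c j * star (c j) - b j * star (b j)) := by
    rw [← Finset.sum_neg_distrib]
    exact Finset.sum_congr rfl fun j _ => by ring
  rw [hM] at key
  rw [hK, hJ]
  simp only [A, B, C, J₀, hJ0, div_eq_mul_inv, ← hx]
  simp only [div_eq_mul_inv] at key
  generalize (∑ j, (c j * star (c j) - b j * star (b j)) * x j) = S at *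
  generalize (∑ j, (c j * star (c j) - b j * star (b j))) = D at *
  generalize (∑ j, b j * star (c j) * x j) = P at *
  generalize (∑ j, c j * star (b j) * x j) = Q at *
  generalize (∑ j, (∑ k ∈ Finset.univ.erase j, _) * x j) = N at *
  generalize (∑ j, _ * x j ^ 2) = R at *
  clear_value a
  ring_nf
  simp only [I_sq]
  linear_combination (-a ^ 2 / 4) * key
end

section
/- Let n ≥ 1, let ε₁,…,εₙ be real constants, and let u, b₁,…,bₙ, c₁,…,cₙ : ℝ → ℂ be differentiable functions satisfying the restricted multiple three-wave interaction system i·bⱼ' + u·cⱼ − (εⱼ/2)·bⱼ = 0, i·cⱼ' + conj(u)·bⱼ + (εⱼ/2)·cⱼ = 0, i·u' + Σⱼ bⱼ·conj(cⱼ) = 0. Then for every λ ∈ ℂ with λ ≠ εⱼ for all j, the function ξ ↦ A(ξ,λ)² + B(ξ,λ)·C(ξ,λ) is constant in ξ, where A = a(λ)(−iλ/2 + (i/2)Σⱼ (|cⱼ|² − |bⱼ|²)/(λ−εⱼ)), B = a(λ)(iu − iΣⱼ bⱼ·conj(cⱼ)/(λ−εⱼ)), C = a(λ)(i·conj(u)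 − iΣⱼ cⱼ·conj(bⱼ)/(λ−εⱼ)), and a(λ) = ∏ⱼ (λ−εⱼ). -/
open Complex

/-- Isospectrality of the Lax flow: along solutions of the restricted
multiple three wave interaction system, `A(ξ,λ)² + B(ξ,λ)·C(ξ,λ)` is constant in `ξ`. -/
theorem spectral_invariant_is_conserved
    (n : ℕ) (hn : 1 ≤ n) (ε : Fin n → ℝ)
    (u : ℝ → ℂ) (b c : Fin n → ℝ → ℂ)
    (hu : Differentiable ℝ u)
    (hb : ∀ j, Differentiable ℝ (b j))
    (hc : ∀ j, Differentiable ℝ (c j))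
    (eqb : ∀ j ξ, I * deriv (b j) ξ + u ξ * c j ξ - (ε j : ℂ) / 2 * b j ξ = 0)
    (eqc : ∀ j ξ, I * deriv (c j) ξ + star (u ξ) * b j ξ + (ε j : ℂ) / 2 * c j ξ = 0)
    (equ : ∀ ξ, I * deriv u ξ + ∑ j, b j ξ * star (c j ξ) = 0)
    (lam : ℂ) (hlam : ∀ j, lam ≠ (ε j : ℂ)) :
    let a : ℂ := ∏ j, (lam - (ε j : ℂ))
    let A : ℝ → ℂ := fun ξ => a * (-I * lam / 2
      + I / 2 * ∑ j, (c j ξ * star (c j ξ) - b j ξ * star (b j ξ)) / (lam - (ε j : ℂ)))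
    let B : ℝ → ℂ := fun ξ => a * (I * u ξ
      - I * ∑ j, b j ξ * star (c j ξ) / (lam - (ε j : ℂ)))
    let C : ℝ → ℂ := fun ξ => a * (I * star (u ξ)
      - I * ∑ j, c j ξ * star (b j ξ) / (lam - (ε j : ℂ)))
    ∀ ξ₁ ξ₂ : ℝ, A ξ₁ ^ 2 + B ξ₁ * C ξ₁ = A ξ₂ ^ 2 + B ξ₂ * C ξ₂ := by
  intro a A B C
  have hI : I * I = -1 := I_mul_I
  have hl : ∀ j, lam - (ε j : ℂ) ≠ 0 := fun j => sub_ne_zero.mpr (hlam j)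
  have Db : ∀ j ξ, HasDerivAt (b j) (I * u ξ * c j ξ - I * (ε j : ℂ) / 2 * b j ξ) ξ := by
    intro j ξ
    have h := (hb j ξ).hasDerivAt
    have e : deriv (b j) ξ = I * u ξ * c j ξ - I * (ε j : ℂ) / 2 * b j ξ := by
      linear_combination (-I) * eqb j ξ + deriv (b j) ξ * hI
    rwa [e] at h
  have Dc : ∀ j ξ, HasDerivAt (c j) (I * star (u ξ) * b j ξ + I * (ε j : ℂ) / 2 * c j ξ) ξ := by
    intro j ξ
    have h := (hc j ξ).hasDerivAt
    have e : deriv (c j) ξ = I * star (u ξ) * b j ξ + I * (ε j : ℂ) / 2 * c j ξ := by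
      linear_combination (-I) * eqc j ξ + deriv (c j) ξ * hI
    rwa [e] at h
  have Du : ∀ ξ, HasDerivAt u (I * ∑ j, b j ξ * star (c j ξ)) ξ := by
    intro ξ
    have h := (hu ξ).hasDerivAt
    have e : deriv u ξ = I * ∑ j, b j ξ * star (c j ξ) := by
      linear_combination (-I) * equ ξ + deriv u ξ * hI
    rwa [e] at h
  have sI : star I = -I := conj_I
  have sε : ∀ j, star (ε j : ℂ) = (ε j : ℂ) := fun j => conj_ofReal _
  have s2 : star (2 : ℂ) = 2 := by simp
  have Dbs : ∀ j ξ, HasDerivAt (fun x => star (b j x))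
      (-I * star (u ξ) * star (c j ξ) + I * (ε j : ℂ) / 2 * star (b j ξ)) ξ := by
    intro j ξ
    refine (Db j ξ).star.congr_deriv ?_
    simp only [star_sub, star_mul', star_div₀, sI, sε, s2]
    ring
  have Dcs : ∀ j ξ, HasDerivAt (fun x => star (c j x))
      (-I * u ξ * star (b j ξ) - I * (ε j : ℂ) / 2 * star (c j ξ)) ξ := by
    intro j ξ
    refine (Dc j ξ).star.congr_deriv ?_
    simp only [star_add, star_mul', star_div₀, sI, sε, s2, star_star]
    ring
  have Dus : ∀ ξ, HasDerivAt (fun x => star (u x)) (-I * ∑ j, c j ξ * star (b j ξ)) ξ := by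
    intro ξ
    refine (Du ξ).star.congr_deriv ?_
    simp only [star_mul', star_sum, sI, star_star]
    congr 1
    exact Finset.sum_congr rfl fun j _ => mul_comm _ _
  let S : ℝ → ℂ := fun ξ =>
    ∑ j, (c j ξ * star (c j ξ) - b j ξ * star (b j ξ)) / (lam - (ε j : ℂ))
  let P : ℝ → ℂ := fun ξ => ∑ j, b j ξ * star (c j ξ) / (lam - (ε j : ℂ))
  let Q : ℝ → ℂ := fun ξ => ∑ j, c j ξ * star (b j ξ) / (lam - (ε j : ℂ))
  have DS : ∀ ξ, HasDerivAt S (2 * I * (star (u ξ) * P ξ - u ξ * Q ξ)) ξ := by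
    intro ξ
    have h := HasDerivAt.fun_sum (u := Finset.univ) fun j _ =>
      ((((Dc j ξ).fun_mul (Dcs j ξ)).fun_sub ((Db j ξ).fun_mul (Dbs j ξ))).div_const
        (lam - (ε j : ℂ)))
    refine h.congr_deriv ?_
    simp only [P, Q, Finset.mul_sum, ← Finset.sum_sub_distrib]
    refine Finset.sum_congr rfl fun j _ => ?_
    have := hl j
    field_simp
    ring
  have DP : ∀ ξ, HasDerivAt P
      (I * u ξ * S ξ - I * lam * P ξ + I * ∑ j, b j ξ * star (c j ξ)) ξ := by
    intro ξ
    have h := HasDerivAt.fun_sum (u := Finset.univ) fun j _ =>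
      (((Db j ξ).fun_mul (Dcs j ξ)).div_const (lam - (ε j : ℂ)))
    refine h.congr_deriv ?_
    simp only [P, S, Finset.mul_sum, ← Finset.sum_sub_distrib, ← Finset.sum_add_distrib]
    refine Finset.sum_congr rfl fun j _ => ?_
    have := hl j
    field_simp
    ring
  have DQ : ∀ ξ, HasDerivAt Q
      (-I * star (u ξ) * S ξ + I * lam * Q ξ - I * ∑ j, c j ξ * star (b j ξ)) ξ := by
    intro ξ
    have h := HasDerivAt.fun_sum (u := Finset.univ) fun j _ =>
      (((Dc j ξ).fun_mul (Dbs j ξ)).div_const (lam - (ε j : ℂ)))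
    refine h.congr_deriv ?_
    simp only [Q, S, Finset.mul_sum, ← Finset.sum_sub_distrib, ← Finset.sum_add_distrib]
    refine Finset.sum_congr rfl fun j _ => ?_
    have := hl j
    field_simp
    ring
  have DF : ∀ ξ, HasDerivAt (fun x => (S x - lam) * (S x - lam) / 4
      + (u x - P x) * (star (u x) - Q x)) 0 ξ := by
    intro ξ
    have hS := (DS ξ).sub_const lam
    refine (((hS.fun_mul hS).div_const 4).fun_add
      (((Du ξ).fun_sub (DP ξ)).fun_mul ((Dus ξ).fun_sub (DQ ξ)))).congr_deriv ?_
    ring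
  intro ξ₁ ξ₂
  have key := is_const_of_deriv_eq_zero (fun ξ => (DF ξ).differentiableAt)
    (fun ξ => (DF ξ).deriv) ξ₁ ξ₂
  have hA : ∀ ξ, A ξ ^ 2 + B ξ * C ξ = -a ^ 2 * ((S ξ - lam) * (S ξ - lam) / 4
      + (u ξ - P ξ) * (star (u ξ) - Q ξ)) := by
    intro ξ
    have e1 : A ξ = a * (-I * lam / 2 + I / 2 * S ξ) := rfl
    have e2 : B ξ = a * (I * u ξ - I * P ξ) := rfl
    have e3 : C ξ = a * (I * star (u ξ) - I * Q ξ) := rfl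
    rw [e1, e2, e3]
    linear_combination a ^ 2 * ((S ξ - lam) * (S ξ - lam) / 4
      + (u ξ - P ξ) * (star (u ξ) - Q ξ)) * hI
  rw [hA, hA]
  exact congrArg _ key
end

section
/- Fix n ≥ 1 and pairwise distinct real numbers ε₁,…,εₙ. On the space with complex coordinates z = (u, u*, b₁,…,bₙ, b₁*,…,bₙ*, c₁,…,cₙ, c₁*,…,cₙ*) (treated as independent variables), define for differentiable functions f, g the bracket {f,g}₀ = −i(∂f/∂u·∂g/∂u* − ∂f/∂u*·∂g/∂u) − iΣⱼ(∂f/∂bⱼ·∂g/∂bⱼ* − ∂f/∂bⱼ*·∂g/∂bⱼ) − iΣⱼ(∂f/∂cⱼ·∂g/∂cⱼ* − ∂f/∂cⱼ*·∂g/∂cⱼ). Define 𝒜(λ) = −iλ/2 + (i/2)Σⱼ(cⱼcⱼ* − bⱼbⱼ*)/(λ−εⱼ), ℬ(λ) = iu − iΣⱼ bⱼcⱼ*/(λ−εⱼ), 𝒞(λ) = iu* − iΣⱼ cⱼbⱼ*/(λ−εⱼ). Then for all λ, μ ∈ ℂ with λ ≠ μ and λ, μ ∉ {ε₁,…,εₙ}: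 {𝒜(λ),𝒜(μ)}₀ = {ℬ(λ),ℬ(μ)}₀ = {𝒞(λ),𝒞(μ)}₀ = 0, {𝒜(λ),ℬ(μ)}₀ = (ℬ(μ) − ℬ(λ))/(λ−μ), {𝒜(λ),𝒞(μ)}₀ = −(𝒞(μ) − 𝒞(λ))/(λ−μ), and {ℬ(λ),𝒞(μ)}₀ = 2(𝒜(μ) − 𝒜(λ))/(λ−μ). -/
open Complex

namespace ThreeWaveBracket

/-- Index type for the coordinates `u, u*, bⱼ, bⱼ*, cⱼ, cⱼ*` (starred variables are
independent coordinates): `.inl 0 = u`, `.inl 1 = u*`, `.inr (.inl (0,j)) = bⱼ`,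
`.inr (.inl (1,j)) = bⱼ*`, `.inr (.inr (0,j)) = cⱼ`, `.inr (.inr (1,j)) = cⱼ*`. -/
abbrev Idx (n : ℕ) := Fin 2 ⊕ ((Fin 2 × Fin n) ⊕ (Fin 2 × Fin n))

/-- Partial derivative of `f` with respect to the coordinate `a` at the point `z`. -/
noncomputable def pd {n : ℕ} (a : Idx n) (f : (Idx n → ℂ) → ℂ) (z : Idx n → ℂ) : ℂ :=
  fderiv ℂ f z (Pi.single a 1)

/-- The standard Poisson bracket
`{f,g}₀ = −i(f_u g_{u*} − f_{u*} g_u) − iΣⱼ(f_{bⱼ} g_{bⱼ*} − f_{bⱼ*} g_{bⱼ})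
 − iΣⱼ(f_{cⱼ} g_{cⱼ*} − f_{cⱼ*} g_{cⱼ})`. -/
noncomputable def br {n : ℕ} (f g : (Idx n → ℂ) → ℂ) (z : Idx n → ℂ) : ℂ :=
  -I * (pd (.inl 0) f z * pd (.inl 1) g z - pd (.inl 1) f z * pd (.inl 0) g z)
  - I * ∑ j : Fin n, (pd (.inr (.inl (0, j))) f z * pd (.inr (.inl (1, j))) g z
      - pd (.inr (.inl (1, j))) f z * pd (.inr (.inl (0, j))) g z)
  - I * ∑ j : Fin n, (pd (.inr (.inr (0, j))) f z * pd (.inr (.inr (1, j))) g z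
      - pd (.inr (.inr (1, j))) f z * pd (.inr (.inr (0, j))) g z)

/-- `𝒜(λ) = −iλ/2 + (i/2)Σⱼ(cⱼcⱼ* − bⱼbⱼ*)/(λ−εⱼ)`. -/
noncomputable def 𝒜 {n : ℕ} (ε : Fin n → ℝ) (lam : ℂ) (z : Idx n → ℂ) : ℂ :=
  -I * lam / 2 + I / 2 * ∑ j, (z (.inr (.inr (0, j))) * z (.inr (.inr (1, j)))
    - z (.inr (.inl (0, j))) * z (.inr (.inl (1, j)))) / (lam - (ε j : ℂ))

/-- `ℬ(λ) = iu − iΣⱼ bⱼcⱼ*/(λ−εⱼ)`. -/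
noncomputable def ℬ {n : ℕ} (ε : Fin n → ℝ) (lam : ℂ) (z : Idx n → ℂ) : ℂ :=
  I * z (.inl 0) - I * ∑ j, z (.inr (.inl (0, j))) * z (.inr (.inr (1, j))) / (lam - (ε j : ℂ))

/-- `𝒞(λ) = iu* − iΣⱼ cⱼbⱼ*/(λ−εⱼ)`. -/
noncomputable def 𝒞 {n : ℕ} (ε : Fin n → ℝ) (lam : ℂ) (z : Idx n → ℂ) : ℂ :=
  I * z (.inl 1) - I * ∑ j, z (.inr (.inr (0, j))) * z (.inr (.inl (1, j))) / (lam - (ε j : ℂ))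

lemma hasA {n : ℕ} (ε : Fin n → ℝ) (lam : ℂ) (z v : Idx n → ℂ) :
    fderiv ℂ (𝒜 ε lam) z v = I / 2 * ∑ j, (z (.inr (.inr (0, j))) * v (.inr (.inr (1, j)))
      + v (.inr (.inr (0, j))) * z (.inr (.inr (1, j)))
      - (z (.inr (.inl (0, j))) * v (.inr (.inl (1, j)))
      + v (.inr (.inl (0, j))) * z (.inr (.inl (1, j))))) / (lam - (ε j : ℂ)) := by
  have p : ∀ a : Idx n, HasFDerivAt (fun z : Idx n → ℂ => z a)
    (ContinuousLinearMap.proj (R := ℂ) (φ := fun _ : Idx n => ℂ) a) z := fun a => hasFDerivAt_apply a z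
  have h := ((HasFDerivAt.fun_sum (u := Finset.univ) (fun j _ =>
    (((p (.inr (.inr (0, j)))).mul (p (.inr (.inr (1, j))))).sub
      ((p (.inr (.inl (0, j)))).mul (p (.inr (.inl (1, j)))))).mul_const
        ((lam - (ε j : ℂ))⁻¹))).const_mul (I / 2)).const_add (-I * lam / 2)
  have h2 : HasFDerivAt (𝒜 ε lam) _ z := h
  rw [h2.fderiv]
  simp only [smul_apply, sum_apply,
    sub_apply, add_apply, ContinuousLinearMap.proj_apply,
    smul_eq_mul]
  congr 1
  refine Finset.sum_congr rfl fun j _ => ?_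
  ring

lemma hasB {n : ℕ} (a₀ : Idx n) (a b : Fin n → Idx n) (ε : Fin n → ℝ) (lam : ℂ) (z v : Idx n → ℂ) :
    fderiv ℂ (fun z : Idx n → ℂ => I * z a₀ - I * ∑ j, z (a j) * z (b j) / (lam - (ε j : ℂ))) z v
    = I * v a₀ - I * ∑ j, (z (a j) * v (b j) + v (a j) * z (b j)) / (lam - (ε j : ℂ)) := by
  have p : ∀ a : Idx n, HasFDerivAt (fun z : Idx n → ℂ => z a)
    (ContinuousLinearMap.proj (R := ℂ) (φ := fun _ : Idx n => ℂ) a) z := fun a => hasFDerivAt_apply a z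
  have h := ((p a₀).const_mul I).sub ((HasFDerivAt.fun_sum (u := Finset.univ) (fun j _ =>
    ((p (a j)).mul (p (b j))).mul_const ((lam - (ε j : ℂ))⁻¹))).const_mul I)
  have h2 : HasFDerivAt (fun z : Idx n → ℂ =>
    I * z a₀ - I * ∑ j, z (a j) * z (b j) / (lam - (ε j : ℂ))) _ z := h
  rw [h2.fderiv]
  simp only [smul_apply, sum_apply,
    sub_apply, add_apply, ContinuousLinearMap.proj_apply,
    smul_eq_mul]
  congr 2
  refine Finset.sum_congr rfl fun j _ => ?_
  ring

lemma hasB' {n : ℕ} (ε : Fin n → ℝ) (lam : ℂ) (z v : Idx n → ℂ) :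
    fderiv ℂ (ℬ ε lam) z v = I * v (.inl 0) - I * ∑ j, (z (.inr (.inl (0, j))) * v (.inr (.inr (1, j)))
      + v (.inr (.inl (0, j))) * z (.inr (.inr (1, j)))) / (lam - (ε j : ℂ)) :=
  hasB (.inl 0) (fun j => .inr (.inl (0, j))) (fun j => .inr (.inr (1, j))) ε lam z v

lemma hasC' {n : ℕ} (ε : Fin n → ℝ) (lam : ℂ) (z v : Idx n → ℂ) :
    fderiv ℂ (𝒞 ε lam) z v = I * v (.inl 1) - I * ∑ j, (z (.inr (.inr (0, j))) * v (.inr (.inl (1, j)))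
      + v (.inr (.inr (0, j))) * z (.inr (.inl (1, j)))) / (lam - (ε j : ℂ)) :=
  hasB (.inl 1) (fun j => .inr (.inr (0, j))) (fun j => .inr (.inl (1, j))) ε lam z v

/-- the entries `𝒜, ℬ, 𝒞` of the normalized Lax matrix satisfy the
linear `r`-matrix Poisson bracket relations with respect to `{·,·}₀`. -/
theorem r_matrix_relations
    (n : ℕ) (hn : 1 ≤ n) (ε : Fin n → ℝ) (hε : Function.Injective ε)
    (lam mu : ℂ) (hne : lam ≠ mu)
    (hlam : ∀ j, lam ≠ (ε j : ℂ)) (hmu : ∀ j, mu ≠ (ε j : ℂ))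
    (z : Idx n → ℂ) :
    br (𝒜 ε lam) (𝒜 ε mu) z = 0 ∧
    br (ℬ ε lam) (ℬ ε mu) z = 0 ∧
    br (𝒞 ε lam) (𝒞 ε mu) z = 0 ∧
    br (𝒜 ε lam) (ℬ ε mu) z = (ℬ ε mu z - ℬ ε lam z) / (lam - mu) ∧
    br (𝒜 ε lam) (𝒞 ε mu) z = -((𝒞 ε mu z - 𝒞 ε lam z) / (lam - mu)) ∧
    br (ℬ ε lam) (𝒞 ε mu) z = 2 * (𝒜 ε mu z - 𝒜 ε lam z) / (lam - mu) := by
  have key : ∀ j, (mu - (ε j : ℂ))⁻¹ - (lam - (ε j : ℂ))⁻¹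
      = (lam - mu) * ((lam - (ε j : ℂ))⁻¹ * (mu - (ε j : ℂ))⁻¹) := by
    intro j
    have h1 := sub_ne_zero.2 (hlam j)
    have h2 := sub_ne_zero.2 (hmu j)
    field_simp
    ring
  have S : ∀ F : Fin n → ℂ, ∑ j, F j / (mu - (ε j : ℂ)) - ∑ j, F j / (lam - (ε j : ℂ))
      = (lam - mu) * ∑ j, F j * ((lam - (ε j : ℂ))⁻¹ * (mu - (ε j : ℂ))⁻¹) := by
    intro F
    rw [← Finset.sum_sub_distrib, Finset.mul_sum]
    refine Finset.sum_congr rfl fun j _ => ?_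
    linear_combination F j * key j
  have hd := sub_ne_zero.2 hne
  have hI : I * I = -1 := I_mul_I
  refine ⟨?_, ?_, ?_, ?_, ?_, ?_⟩
  all_goals
    simp only [br, pd, hasA, hasB', hasC', Pi.single_apply, Sum.inr.injEq, Sum.inl.injEq,
      Prod.mk.injEq, reduceCtorEq, if_false, mul_zero, zero_mul, add_zero, zero_add, sub_zero,
      zero_sub, zero_div, Finset.sum_const_zero, true_and, false_and, zero_ne_one, one_ne_zero,
      if_true, mul_ite, ite_mul, mul_one, one_mul, ite_div, Finset.sum_ite_eq',
      Finset.mem_univ, neg_zero, Finset.sum_neg_distrib, neg_ite]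
  · rw [Finset.sum_eq_zero (fun j _ => by ring), Finset.sum_eq_zero (fun j _ => by ring)]
    ring
  · have h := S (fun j => z (.inr (.inl (0, j))) * z (.inr (.inr (1, j))))
    rw [eq_div_iff hd, ℬ, ℬ]
    trans -I * ((lam - mu) * ∑ j, z (.inr (.inl (0, j))) * z (.inr (.inr (1, j))) *
      ((lam - (ε j : ℂ))⁻¹ * (mu - (ε j : ℂ))⁻¹))
    · simp only [Finset.mul_sum, Finset.sum_mul, ← Finset.sum_neg_distrib,
        ← Finset.sum_sub_distrib]
      refine Finset.sum_congr rfl fun j _ => ?_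
      ring_nf
      simp only [I_pow_three]
      ring
    · linear_combination I * h
  · have h := S (fun j => z (.inr (.inr (0, j))) * z (.inr (.inl (1, j))))
    rw [← neg_div, eq_div_iff hd, 𝒞, 𝒞]
    trans I * ((lam - mu) * ∑ j, z (.inr (.inr (0, j))) * z (.inr (.inl (1, j))) *
      ((lam - (ε j : ℂ))⁻¹ * (mu - (ε j : ℂ))⁻¹))
    · simp only [Finset.mul_sum, Finset.sum_mul, ← Finset.sum_neg_distrib,
        ← Finset.sum_sub_distrib]
      refine Finset.sum_congr rfl fun j _ => ?_
      ring_nf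
      simp only [I_pow_three]
      ring
    · linear_combination -I * h
  · have h := S (fun j => z (.inr (.inr (0, j))) * z (.inr (.inr (1, j)))
      - z (.inr (.inl (0, j))) * z (.inr (.inl (1, j))))
    rw [eq_div_iff hd, 𝒜, 𝒜, hI, sub_sub, sub_mul]
    trans I * (lam - mu) + I * ((lam - mu) * ∑ j, (z (.inr (.inr (0, j))) * z (.inr (.inr (1, j)))
      - z (.inr (.inl (0, j))) * z (.inr (.inl (1, j)))) *
      ((lam - (ε j : ℂ))⁻¹ * (mu - (ε j : ℂ))⁻¹))
    · rw [sub_eq_add_neg]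
      congr 1
      · ring
      simp only [Finset.mul_sum, Finset.sum_mul, ← Finset.sum_neg_distrib,
        ← Finset.sum_add_distrib]
      refine Finset.sum_congr rfl fun j _ => ?_
      ring_nf
      simp only [I_pow_three]
      ring
    · linear_combination -I * h

end ThreeWaveBracket
end

section
/- Fix n ≥ 1 and pairwise distinct real numbers ε₁,…,εₙ, and let 𝒜, ℬ, 𝒞 and the bracket {·,·}₀ be as follows: 𝒜(λ) = −iλ/2 + (i/2)Σⱼ(cⱼcⱼ* − bⱼbⱼ*)/(λ−εⱼ), ℬ(λ) = iu − iΣⱼ bⱼcⱼ*/(λ−εⱼ), 𝒞(λ) = iu* − iΣⱼ cⱼbⱼ*/(λ−εⱼ), and {f,g}₀ = −i(∂f/∂u·∂g/∂u* − ∂f/∂u*·∂g/∂u) − iΣⱼ(∂f/∂bⱼ·∂g/∂bⱼ* − ∂f/∂bⱼ*·∂g/∂bⱼ) − iΣⱼ(∂f/∂cⱼ·∂g/∂cⱼ* − ∂f/∂cⱼ*·∂g/∂cⱼ). Let ℒ(λ) = [[𝒜(λ), ℬ(λ)],[𝒞(λ), −𝒜(λ)]], and on ℂ²⊗ℂ²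 let ℒ₁(λ) = ℒ(λ)⊗I, ℒ₂(μ) = I⊗ℒ(μ), and r(λ−μ) = Π/(λ−μ) where Π is the 4×4 matrix [[1,0,0,0],[0,0,1,0],[0,1,0,0],[0,0,0,1]]. Then for all λ ≠ μ with λ, μ ∉ {ε₁,…,εₙ}, the 4×4 matrix whose (ab,cd) entry is {ℒ(λ)_{ac}, ℒ(μ)_{bd}}₀ equals the commutator [r(λ−μ), ℒ₁(λ) + ℒ₂(μ)]. -/
open Complex Matrix Kronecker

namespace ThreeWaveRMatrix

/-- Index type for the coordinates `u, u*, bⱼ, bⱼ*, cⱼ, cⱼ*`: `.inl 0 = u`,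
`.inl 1 = u*`, `.inr (.inl (0,j)) = bⱼ`, `.inr (.inl (1,j)) = bⱼ*`,
`.inr (.inr (0,j)) = cⱼ`, `.inr (.inr (1,j)) = cⱼ*`. -/
abbrev Idx (n : ℕ) := Fin 2 ⊕ ((Fin 2 × Fin n) ⊕ (Fin 2 × Fin n))

/-- Partial derivative of `f` with respect to the coordinate `a` at the point `z`. -/
noncomputable def pd {n : ℕ} (a : Idx n) (f : (Idx n → ℂ) → ℂ) (z : Idx n → ℂ) : ℂ :=
  fderiv ℂ f z (Pi.single a 1)

/-- The standard Poisson bracket `{f,g}₀`. -/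
noncomputable def br {n : ℕ} (f g : (Idx n → ℂ) → ℂ) (z : Idx n → ℂ) : ℂ :=
  -I * (pd (.inl 0) f z * pd (.inl 1) g z - pd (.inl 1) f z * pd (.inl 0) g z)
  - I * ∑ j : Fin n, (pd (.inr (.inl (0, j))) f z * pd (.inr (.inl (1, j))) g z
      - pd (.inr (.inl (1, j))) f z * pd (.inr (.inl (0, j))) g z)
  - I * ∑ j : Fin n, (pd (.inr (.inr (0, j))) f z * pd (.inr (.inr (1, j))) g z
      - pd (.inr (.inr (1, j))) f z * pd (.inr (.inr (0, j))) g z)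

/-- The normalized Lax matrix `ℒ(λ) = [[𝒜, ℬ],[𝒞, −𝒜]]`. -/
noncomputable def ℒ {n : ℕ} (ε : Fin n → ℝ) (lam : ℂ) (z : Idx n → ℂ) :
    Matrix (Fin 2) (Fin 2) ℂ :=
  let 𝒜 : ℂ := -I * lam / 2 + I / 2 * ∑ j, (z (.inr (.inr (0, j))) * z (.inr (.inr (1, j)))
    - z (.inr (.inl (0, j))) * z (.inr (.inl (1, j)))) / (lam - (ε j : ℂ))
  let ℬ : ℂ := I * z (.inl 0)
    - I * ∑ j, z (.inr (.inl (0, j))) * z (.inr (.inr (1, j))) / (lam - (ε j : ℂ))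
  let 𝒞 : ℂ := I * z (.inl 1)
    - I * ∑ j, z (.inr (.inr (0, j))) * z (.inr (.inl (1, j))) / (lam - (ε j : ℂ))
  !![𝒜, ℬ; 𝒞, -𝒜]

/-- The permutation matrix `Π = [[1,0,0,0],[0,0,1,0],[0,1,0,0],[0,0,0,1]]`
exchanging the two tensor factors of `ℂ²⊗ℂ²`. -/
def Pmat : Matrix (Fin 2 × Fin 2) (Fin 2 × Fin 2) ℂ :=
  fun p q => if p.1 = q.2 ∧ p.2 = q.1 then 1 else 0


lemma fd_A {n : ℕ} (ε : Fin n → ℝ) (lam : ℂ) (z v : Idx n → ℂ) :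
    fderiv ℂ (fun w => ℒ ε lam w 0 0) z v = I / 2 * ∑ j, ((z (.inr (.inr (0, j))) * v (.inr (.inr (1, j)))
    + z (.inr (.inr (1, j))) * v (.inr (.inr (0, j))))
    - (z (.inr (.inl (0, j))) * v (.inr (.inl (1, j)))
    + z (.inr (.inl (1, j))) * v (.inr (.inl (0, j))))) * (lam - (ε j : ℂ))⁻¹ := by
  have hp : ∀ a : Idx n, HasFDerivAt (fun w : Idx n → ℂ => w a)
    (ContinuousLinearMap.proj (R := ℂ) (φ := fun _ : Idx n => ℂ) a) z := fun a => hasFDerivAt_apply a z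
  have h := ((HasFDerivAt.fun_sum (u := Finset.univ) (fun (j : Fin n) _ =>
    ((((hp (.inr (.inr (0, j)))).mul (hp (.inr (.inr (1, j))))).sub
     ((hp (.inr (.inl (0, j)))).mul (hp (.inr (.inl (1, j)))))).mul_const
      ((lam - (ε j : ℂ))⁻¹)))).const_mul (I / 2)).const_add (-I * lam / 2)
  have h2 : (fun w => ℒ ε lam w 0 0) = fun w : Idx n → ℂ => -I * lam / 2 + I / 2 * ∑ j, (w (.inr (.inr (0, j))) * w (.inr (.inr (1, j)))
    - w (.inr (.inl (0, j))) * w (.inr (.inl (1, j)))) * (lam - (ε j : ℂ))⁻¹ := by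
    funext w
    simp [ℒ, div_eq_mul_inv]
  rw [h2]
  refine (congrArg (fun T => T v) h.fderiv).trans ?_
  simp
  refine Finset.sum_congr rfl fun j _ => ?_
  ring

lemma fd_D {n : ℕ} (ε : Fin n → ℝ) (lam : ℂ) (z v : Idx n → ℂ) :
    fderiv ℂ (fun w => ℒ ε lam w 1 1) z v = - fderiv ℂ (fun w => ℒ ε lam w 0 0) z v := by
  have h2 : (fun w : Idx n → ℂ => ℒ ε lam w 1 1) = fun w => - ℒ ε lam w 0 0 := by
    funext w
    simp [ℒ]
  rw [h2, fderiv_fun_neg]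
  rfl

lemma fd_B {n : ℕ} (ε : Fin n → ℝ) (lam : ℂ) (z v : Idx n → ℂ) :
    fderiv ℂ (fun w => ℒ ε lam w 0 1) z v = I * v (.inl 0) - I * ∑ j, (z (.inr (.inl (0, j))) * v (.inr (.inr (1, j)))
    + z (.inr (.inr (1, j))) * v (.inr (.inl (0, j)))) * (lam - (ε j : ℂ))⁻¹ := by
  have hp : ∀ a : Idx n, HasFDerivAt (fun w : Idx n → ℂ => w a)
    (ContinuousLinearMap.proj (R := ℂ) (φ := fun _ : Idx n => ℂ) a) z := fun a => hasFDerivAt_apply a z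
  have h := ((hp (.inl 0)).const_mul I).sub ((HasFDerivAt.fun_sum (u := Finset.univ) (fun (j : Fin n) _ =>
    (((hp (.inr (.inl (0, j)))).mul (hp (.inr (.inr (1, j))))).mul_const
      ((lam - (ε j : ℂ))⁻¹)))).const_mul I)
  have h2 : (fun w => ℒ ε lam w 0 1) = fun w : Idx n → ℂ => I * w (.inl 0) - I * ∑ j, w (.inr (.inl (0, j))) * w (.inr (.inr (1, j))) * (lam - (ε j : ℂ))⁻¹ := by
    funext w
    simp [ℒ, div_eq_mul_inv]
  rw [h2]
  refine (congrArg (fun T => T v) h.fderiv).trans ?_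
  simp
  refine Finset.sum_congr rfl fun j _ => ?_
  ring

lemma fd_C {n : ℕ} (ε : Fin n → ℝ) (lam : ℂ) (z v : Idx n → ℂ) :
    fderiv ℂ (fun w => ℒ ε lam w 1 0) z v = I * v (.inl 1) - I * ∑ j, (z (.inr (.inr (0, j))) * v (.inr (.inl (1, j)))
    + z (.inr (.inl (1, j))) * v (.inr (.inr (0, j)))) * (lam - (ε j : ℂ))⁻¹ := by
  have hp : ∀ a : Idx n, HasFDerivAt (fun w : Idx n → ℂ => w a)
    (ContinuousLinearMap.proj (R := ℂ) (φ := fun _ : Idx n => ℂ) a) z := fun a => hasFDerivAt_apply a z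
  have h := ((hp (.inl 1)).const_mul I).sub ((HasFDerivAt.fun_sum (u := Finset.univ) (fun (j : Fin n) _ =>
    (((hp (.inr (.inr (0, j)))).mul (hp (.inr (.inl (1, j))))).mul_const
      ((lam - (ε j : ℂ))⁻¹)))).const_mul I)
  have h2 : (fun w => ℒ ε lam w 1 0) = fun w : Idx n → ℂ => I * w (.inl 1) - I * ∑ j, w (.inr (.inr (0, j))) * w (.inr (.inl (1, j))) * (lam - (ε j : ℂ))⁻¹ := by
    funext w
    simp [ℒ, div_eq_mul_inv]
  rw [h2]
  refine (congrArg (fun T => T v) h.fderiv).trans ?_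
  simp
  refine Finset.sum_congr rfl fun j _ => ?_
  ring

lemma key (l m e : ℂ) (h : l ≠ m) (hl : l ≠ e) (hm : m ≠ e) :
    (l - e)⁻¹ * (m - e)⁻¹ = (l - m)⁻¹ * ((m - e)⁻¹ - (l - e)⁻¹) := by
  have h1 := sub_ne_zero.2 h
  have h2 := sub_ne_zero.2 hl
  have h3 := sub_ne_zero.2 hm
  field_simp
  ring

set_option maxHeartbeats 4000000 in
/-- the matrix of Poisson brackets of the entries of `ℒ(λ)` and `ℒ(μ)`
equals the commutator `[r(λ−μ), ℒ₁(λ) + ℒ₂(μ)]` with the classical rational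
`r`-matrix `r(λ−μ) = Π/(λ−μ)`. -/
theorem linear_r_matrix_algebra
    (n : ℕ) (hn : 1 ≤ n) (ε : Fin n → ℝ) (hε : Function.Injective ε)
    (lam mu : ℂ) (hne : lam ≠ mu)
    (hlam : ∀ j, lam ≠ (ε j : ℂ)) (hmu : ∀ j, mu ≠ (ε j : ℂ))
    (z : Idx n → ℂ) :
    let L₁ : Matrix (Fin 2 × Fin 2) (Fin 2 × Fin 2) ℂ :=
      ℒ ε lam z ⊗ₖ (1 : Matrix (Fin 2) (Fin 2) ℂ)
    let L₂ : Matrix (Fin 2 × Fin 2) (Fin 2 × Fin 2) ℂ :=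
      (1 : Matrix (Fin 2) (Fin 2) ℂ) ⊗ₖ ℒ ε mu z
    let r : Matrix (Fin 2 × Fin 2) (Fin 2 × Fin 2) ℂ := (lam - mu)⁻¹ • Pmat
    ∀ p q : Fin 2 × Fin 2,
      br (fun w => ℒ ε lam w p.1 q.1) (fun w => ℒ ε mu w p.2 q.2) z
        = (r * (L₁ + L₂) - (L₁ + L₂) * r) p q := by
  intro L₁ L₂ r p q
  have hd : (lam - mu)⁻¹ * (lam - mu) = 1 := inv_mul_cancel₀ (sub_ne_zero.2 hne)
  have hk : ∀ j, (lam - (ε j : ℂ))⁻¹ * (mu - (ε j : ℂ))⁻¹ = (lam - mu)⁻¹ * ((mu - (ε j : ℂ))⁻¹ - (lam - (ε j : ℂ))⁻¹) :=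
    fun j => key _ _ _ hne (hlam j) (hmu j)
  have hI3 : I ^ 3 = -I := by rw [pow_succ, I_sq]; ring
  have hs : ∀ (f g h : Fin n → ℂ), (∀ x, h x = f x * g x) → ∀ k1 k2 : ℂ,
      ∑ x, k1 * (f x * (lam - (ε x : ℂ))⁻¹) * (k2 * (g x * (mu - (ε x : ℂ))⁻¹)) =
      k1 * k2 * (lam - mu)⁻¹ * (∑ x, h x * (mu - (ε x : ℂ))⁻¹ - ∑ x, h x * (lam - (ε x : ℂ))⁻¹) := by
    intro f g h hh k1 k2
    rw [← Finset.sum_sub_distrib, Finset.mul_sum]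
    refine Finset.sum_congr rfl fun x _ => ?_
    rw [hh]
    linear_combination (k1 * k2 * f x * g x) * hk x
  have hbb := hs (fun x => z (.inr (.inl (0, x)))) (fun x => z (.inr (.inl (1, x)))) (fun x => z (.inr (.inl (0, x))) * z (.inr (.inl (1, x)))) (fun x => rfl)
  have hbb' := hs (fun x => z (.inr (.inl (1, x)))) (fun x => z (.inr (.inl (0, x)))) (fun x => z (.inr (.inl (0, x))) * z (.inr (.inl (1, x)))) (fun x => mul_comm _ _)
  have hcc := hs (fun x => z (.inr (.inr (0, x)))) (fun x => z (.inr (.inr (1, x)))) (fun x => z (.inr (.inr (0, x))) * z (.inr (.inr (1, x)))) (fun x => rfl)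
  have hcc' := hs (fun x => z (.inr (.inr (1, x)))) (fun x => z (.inr (.inr (0, x)))) (fun x => z (.inr (.inr (0, x))) * z (.inr (.inr (1, x)))) (fun x => mul_comm _ _)
  have hbc := hs (fun x => z (.inr (.inl (0, x)))) (fun x => z (.inr (.inr (1, x)))) (fun x => z (.inr (.inl (0, x))) * z (.inr (.inr (1, x)))) (fun x => rfl)
  have hbc' := hs (fun x => z (.inr (.inr (1, x)))) (fun x => z (.inr (.inl (0, x)))) (fun x => z (.inr (.inl (0, x))) * z (.inr (.inr (1, x)))) (fun x => mul_comm _ _)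
  have hcb := hs (fun x => z (.inr (.inr (0, x)))) (fun x => z (.inr (.inl (1, x)))) (fun x => z (.inr (.inr (0, x))) * z (.inr (.inl (1, x)))) (fun x => rfl)
  have hcb' := hs (fun x => z (.inr (.inl (1, x)))) (fun x => z (.inr (.inr (0, x)))) (fun x => z (.inr (.inr (0, x))) * z (.inr (.inl (1, x)))) (fun x => mul_comm _ _)
  beta_reduce at hbb hbb' hcc hcc' hbc hbc' hcb hcb'
  obtain ⟨p1, p2⟩ := p
  obtain ⟨q1, q2⟩ := q
  fin_cases p1 <;> fin_cases p2 <;> fin_cases q1 <;> fin_cases q2 <;>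
  simp [br, pd, fd_A, fd_B, fd_C, fd_D, L₁, L₂, r, Matrix.mul_apply, Fintype.sum_prod_type, Pmat, Matrix.one_apply, Pi.single_apply, ite_and]
  all_goals
    try simp only [Finset.sum_add_distrib, Finset.sum_neg_distrib]
    simp only [hbb, hbb', hcc, hcc', hbc, hbc', hcb, hcb']
    try simp only [ℒ, div_eq_mul_inv, sub_mul, Finset.sum_sub_distrib]
    try simp
    try ring_nf
    try simp only [hI3]
    try ring_nf
    try first
      | linear_combination I * hd
      | linear_combination (-I) * hd

end ThreeWaveRMatrix
end

section
/- Fix n ≥ 1 and pairwise distinct real numbers ε₁,…,εₙ. With independent complex coordinates u, u*, bⱼ, bⱼ*, cⱼ, cⱼ* and the bracket {f,g}₀ = −i(∂f/∂u·∂g/∂u* − ∂f/∂u*·∂g/∂u) − iΣⱼ(∂f/∂bⱼ·∂g/∂bⱼ* − ∂f/∂bⱼ*·∂g/∂bⱼ) − iΣⱼ(∂f/∂cⱼ·∂g/∂cⱼ* − ∂f/∂cⱼ*·∂g/∂cⱼ), define J₀ = i·u·u* + (i/2)Σⱼ(bⱼbⱼ* − cⱼcⱼ*), Jⱼ = i(bⱼbⱼ*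 + cⱼcⱼ*), and Kⱼ = i·u·bⱼ*·cⱼ + i·u*·bⱼ·cⱼ* + i(εⱼ/2)(cⱼcⱼ* − bⱼbⱼ*) − (i/2)Σ_{k≠j}[(bⱼbⱼ* − cⱼcⱼ*)(b_kb_k* − c_kc_k*) + 2bⱼ*cⱼb_kc_k* + 2bⱼcⱼ*b_k*c_k]/(εⱼ−ε_k). Then the 2n+1 functions J₀, J₁,…,Jₙ, K₁,…,Kₙ pairwise Poisson-commute: {I, I'}₀ = 0 for any two of them. -/
open Complex

namespace ThreeWaveInvolution

/-- Index type for the coordinates `u, u*, bⱼ, bⱼ*, cⱼ, cⱼ*`: `.inl 0 = u`,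
`.inl 1 = u*`, `.inr (.inl (0,j)) = bⱼ`, `.inr (.inl (1,j)) = bⱼ*`,
`.inr (.inr (0,j)) = cⱼ`, `.inr (.inr (1,j)) = cⱼ*`. -/
abbrev Idx (n : ℕ) := Fin 2 ⊕ ((Fin 2 × Fin n) ⊕ (Fin 2 × Fin n))

/-- Partial derivative of `f` with respect to the coordinate `a` at the point `z`. -/
noncomputable def pd {n : ℕ} (a : Idx n) (f : (Idx n → ℂ) → ℂ) (z : Idx n → ℂ) : ℂ :=
  fderiv ℂ f z (Pi.single a 1)

/-- The standard Poisson bracket `{f,g}₀`. -/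
noncomputable def br {n : ℕ} (f g : (Idx n → ℂ) → ℂ) (z : Idx n → ℂ) : ℂ :=
  -I * (pd (.inl 0) f z * pd (.inl 1) g z - pd (.inl 1) f z * pd (.inl 0) g z)
  - I * ∑ j : Fin n, (pd (.inr (.inl (0, j))) f z * pd (.inr (.inl (1, j))) g z
      - pd (.inr (.inl (1, j))) f z * pd (.inr (.inl (0, j))) g z)
  - I * ∑ j : Fin n, (pd (.inr (.inr (0, j))) f z * pd (.inr (.inr (1, j))) g z
      - pd (.inr (.inr (1, j))) f z * pd (.inr (.inr (0, j))) g z)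

/-- The family of the `2n+1` integrals of motion `J₀, J₁,…,Jₙ, K₁,…,Kₙ`:
`.inl () = J₀`, `.inr (.inl j) = Jⱼ`, `.inr (.inr j) = Kⱼ`. -/
noncomputable def integrals {n : ℕ} (ε : Fin n → ℝ) :
    (Unit ⊕ (Fin n ⊕ Fin n)) → (Idx n → ℂ) → ℂ
  | .inl () => fun z => I * (z (.inl 0) * z (.inl 1))
      + I / 2 * ∑ j, (z (.inr (.inl (0, j))) * z (.inr (.inl (1, j)))
        - z (.inr (.inr (0, j))) * z (.inr (.inr (1, j))))
  | .inr (.inl j) => fun z => I * (z (.inr (.inl (0, j))) * z (.inr (.inl (1, j)))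
      + z (.inr (.inr (0, j))) * z (.inr (.inr (1, j))))
  | .inr (.inr j) => fun z =>
      I * z (.inl 0) * z (.inr (.inl (1, j))) * z (.inr (.inr (0, j)))
      + I * z (.inl 1) * z (.inr (.inl (0, j))) * z (.inr (.inr (1, j)))
      + I * ((ε j : ℂ) / 2) * (z (.inr (.inr (0, j))) * z (.inr (.inr (1, j)))
          - z (.inr (.inl (0, j))) * z (.inr (.inl (1, j))))
      - I / 2 * ∑ k ∈ Finset.univ.erase j,
          ((z (.inr (.inl (0, j))) * z (.inr (.inl (1, j)))
              - z (.inr (.inr (0, j))) * z (.inr (.inr (1, j))))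
            * (z (.inr (.inl (0, k))) * z (.inr (.inl (1, k)))
              - z (.inr (.inr (0, k))) * z (.inr (.inr (1, k))))
          + 2 * z (.inr (.inl (1, j))) * z (.inr (.inr (0, j)))
              * z (.inr (.inl (0, k))) * z (.inr (.inr (1, k)))
          + 2 * z (.inr (.inl (0, j))) * z (.inr (.inr (1, j)))
              * z (.inr (.inl (1, k))) * z (.inr (.inr (0, k))))
          / ((ε j : ℂ) - (ε k : ℂ))

/-- The pairing data. -/
structure G {n : ℕ} (f : (Idx n → ℂ) → ℂ) (z : Idx n → ℂ) (A B : ℂ)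
    (α β γ ν : Fin n → ℂ) : Prop where
  h0 : pd (.inl 0) f z = I * A
  h1 : pd (.inl 1) f z = I * B
  hb : ∀ l, pd (.inr (.inl (0, l))) f z
    = I * (β l * z (.inr (.inr (1, l))) + (γ l + ν l) * z (.inr (.inl (1, l))))
  hbs : ∀ l, pd (.inr (.inl (1, l))) f z
    = I * (α l * z (.inr (.inr (0, l))) + (γ l + ν l) * z (.inr (.inl (0, l))))
  hc : ∀ l, pd (.inr (.inr (0, l))) f z
    = I * (α l * z (.inr (.inl (1, l))) + (ν l - γ l) * z (.inr (.inr (1, l))))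
  hcs : ∀ l, pd (.inr (.inr (1, l))) f z
    = I * (β l * z (.inr (.inl (0, l))) + (ν l - γ l) * z (.inr (.inr (0, l))))

/-- P -/
def P {n : ℕ} (z : Idx n → ℂ) (l : Fin n) : ℂ := z (.inr (.inl (1, l))) * z (.inr (.inr (0, l)))
/-- M -/
def M {n : ℕ} (z : Idx n → ℂ) (l : Fin n) : ℂ := z (.inr (.inl (0, l))) * z (.inr (.inr (1, l)))
/-- D -/
def D {n : ℕ} (z : Idx n → ℂ) (l : Fin n) : ℂ := z (.inr (.inl (0, l))) * z (.inr (.inl (1, l)))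
  - z (.inr (.inr (0, l))) * z (.inr (.inr (1, l)))

theorem G.br_eq {n : ℕ} {f g : (Idx n → ℂ) → ℂ} {z : Idx n → ℂ} {A B A' B' : ℂ}
    {α β γ ν α' β' γ' ν' : Fin n → ℂ} (hf : G f z A B α β γ ν) (hg : G g z A' B' α' β' γ' ν') :
    br f g z = I * ((A * B' - B * A') + ∑ l, ((α l * β' l - β l * α' l) * D z l
      + 2 * (γ l * α' l - α l * γ' l) * P z l - 2 * (γ l * β' l - β l * γ' l) * M z l)) := by
  have hI : I * I = -1 := I_mul_I
  unfold br
  rw [hf.h0, hf.h1, hg.h0, hg.h1, sub_sub, ← mul_add, ← Finset.sum_add_distrib, mul_add, Finset.mul_sum, Finset.mul_sum,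
    sub_eq_add_neg, ← Finset.sum_neg_distrib]
  congr 1
  · linear_combination (-I * (A * B' - B * A')) * hI
  · refine Finset.sum_congr rfl fun l _ => ?_
    rw [hf.hb, hf.hbs, hf.hc, hf.hcs, hg.hb, hg.hbs, hg.hc, hg.hcs]
    linear_combination (norm := (simp only [P, M, D]; ring)) (-I * ((α l * β' l - β l * α' l) * D z l
      + 2 * (γ l * α' l - α l * γ' l) * P z l - 2 * (γ l * β' l - β l * γ' l) * M z l)) * hI

noncomputable abbrev pr {n : ℕ} (a : Idx n) : (Idx n → ℂ) →L[ℂ] ℂ := ContinuousLinearMap.proj a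

theorem hpr {n : ℕ} (a : Idx n) (z : Idx n → ℂ) : HasFDerivAt (fun w : Idx n → ℂ => w a) (pr a) z :=
  (pr a).hasFDerivAt

theorem gJ0 {n : ℕ} (ε : Fin n → ℝ) (z : Idx n → ℂ) :
    G (integrals ε (.inl ())) z (z (.inl 1)) (z (.inl 0)) 0 0 (fun _ => 1/2) 0 := by
  have h := (((hpr (.inl 0) z).mul (hpr (.inl 1) z)).const_mul I).add
    ((HasFDerivAt.fun_sum (u := Finset.univ) fun (l : Fin n) _ =>
      (((hpr (.inr (.inl (0, l))) z).mul (hpr (.inr (.inl (1, l))) z)).sub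
        ((hpr (.inr (.inr (0, l))) z).mul (hpr (.inr (.inr (1, l))) z)))).const_mul (I/2))
  have h' : fderiv ℂ (integrals ε (.inl ())) z = _ := h.fderiv
  constructor <;> intros <;> rw [pd, h'] <;> simp [Pi.single_apply] <;> ring

theorem gJ {n : ℕ} (ε : Fin n → ℝ) (z : Idx n → ℂ) (j : Fin n) :
    G (integrals ε (.inr (.inl j))) z 0 0 0 0 0 (fun l => if j = l then 1 else 0) := by
  have h := ((((hpr (.inr (.inl (0, j))) z).mul (hpr (.inr (.inl (1, j))) z)).add
        ((hpr (.inr (.inr (0, j))) z).mul (hpr (.inr (.inr (1, j))) z)))).const_mul I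
  have h' : fderiv ℂ (integrals ε (.inr (.inl j))) z = _ := h.fderiv
  constructor <;> intros <;> rw [pd, h'] <;> simp [Pi.single_apply]
  all_goals split_ifs with hh <;> first | (subst hh; simp; done) | simp

/-- dP -/
noncomputable def dP {n : ℕ} (z : Idx n → ℂ) (l : Fin n) : (Idx n → ℂ) →L[ℂ] ℂ :=
  z (.inr (.inl (1, l))) • pr (.inr (.inr (0, l))) + z (.inr (.inr (0, l))) • pr (.inr (.inl (1, l)))
/-- dM -/
noncomputable def dM {n : ℕ} (z : Idx n → ℂ) (l : Fin n) : (Idx n → ℂ) →L[ℂ] ℂ :=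
  z (.inr (.inl (0, l))) • pr (.inr (.inr (1, l))) + z (.inr (.inr (1, l))) • pr (.inr (.inl (0, l)))
/-- dD -/
noncomputable def dD {n : ℕ} (z : Idx n → ℂ) (l : Fin n) : (Idx n → ℂ) →L[ℂ] ℂ :=
  (z (.inr (.inl (0, l))) • pr (.inr (.inl (1, l))) + z (.inr (.inl (1, l))) • pr (.inr (.inl (0, l))))
  - (z (.inr (.inr (0, l))) • pr (.inr (.inr (1, l)))
    + z (.inr (.inr (1, l))) • pr (.inr (.inr (0, l))))

theorem hP {n : ℕ} (z : Idx n → ℂ) (l : Fin n) : HasFDerivAt (fun w => P w l) (dP z l) z :=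
  (hpr (.inr (.inl (1, l))) z).mul (hpr (.inr (.inr (0, l))) z)
theorem hM {n : ℕ} (z : Idx n → ℂ) (l : Fin n) : HasFDerivAt (fun w => M w l) (dM z l) z :=
  (hpr (.inr (.inl (0, l))) z).mul (hpr (.inr (.inr (1, l))) z)
theorem hD {n : ℕ} (z : Idx n → ℂ) (l : Fin n) : HasFDerivAt (fun w => D w l) (dD z l) z :=
  ((hpr (.inr (.inl (0, l))) z).mul (hpr (.inr (.inl (1, l))) z)).sub
        ((hpr (.inr (.inr (0, l))) z).mul (hpr (.inr (.inr (1, l))) z))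

theorem G.of_fderiv {n : ℕ} {f : (Idx n → ℂ) → ℂ} {z : Idx n → ℂ} {A B : ℂ}
    {α β γ : Fin n → ℂ} (h : ∀ v, fderiv ℂ f z v = I * (A * v (.inl 0) + B * v (.inl 1)
      + ∑ l, (α l * dP z l v + β l * dM z l v + γ l * dD z l v))) : G f z A B α β γ 0 := by
  constructor <;> intros <;> rw [pd, h] <;>
    simp [Pi.single_apply, dP, dM, dD, Finset.sum_add_distrib]

/-- g -/
noncomputable def g {n : ℕ} (ε : Fin n → ℝ) (j l : Fin n) : ℂ := ((ε j : ℂ) - (ε l : ℂ))⁻¹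

theorem K_eq {n : ℕ} (ε : Fin n → ℝ) (j : Fin n) :
    integrals ε (.inr (.inr j)) = fun z => I * (z (.inl 0) * P z j + z (.inl 1) * M z j
      - (ε j : ℂ) / 2 * D z j
      - 1 / 2 * ∑ l, g ε j l * (D z j * D z l + 2 * (P z j * M z l) + 2 * (M z j * P z l))) := by
  funext z
  rw [← Finset.add_sum_erase _ _ (Finset.mem_univ j)]
  simp only [integrals, P, M, D, g, sub_self, inv_zero, zero_mul, zero_add, div_eq_mul_inv]
  rw [mul_sub I]
  congr 1
  · ring
  · rw [← mul_assoc, Finset.mul_sum, Finset.mul_sum]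
    refine Finset.sum_congr rfl fun l _ => ?_
    ring

theorem gK {n : ℕ} (ε : Fin n → ℝ) (z : Idx n → ℂ) (j : Fin n) :
    G (integrals ε (.inr (.inr j))) z (P z j) (M z j)
      (fun l => (if j = l then z (.inl 0) - ∑ k, g ε j k * M z k else 0) - g ε j l * M z j)
      (fun l => (if j = l then z (.inl 1) - ∑ k, g ε j k * P z k else 0) - g ε j l * P z j)
      (fun l => (if j = l then - (ε j : ℂ) / 2 - 1 / 2 * ∑ k, g ε j k * D z k else 0)
        - 1 / 2 * (g ε j l * D z j)) 0 := by
  have h := ((((((hpr (.inl 0) z).mul (hP z j)).add ((hpr (.inl 1) z).mul (hM z j))).sub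
    ((hD z j).const_mul ((ε j : ℂ) / 2))).sub
    ((HasFDerivAt.fun_sum (u := Finset.univ) fun (l : Fin n) _ =>
      (((((hD z j).mul (hD z l)).add (((hP z j).mul (hM z l)).const_mul 2)).add
        (((hM z j).mul (hP z l)).const_mul 2)).const_mul (g ε j l))).const_mul (1 / 2)))).const_mul I
  rw [K_eq]
  refine G.of_fderiv fun v => ?_
  refine (DFunLike.congr_fun h.fderiv v).trans ?_
  have e1 : ∀ (x : ℂ) (y : Fin n → ℂ), ∑ l, (if j = l then x else 0) * y l = x * y j := by
    intro x y; simp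
  simp only [sub_mul, Finset.sum_add_distrib, Finset.sum_sub_distrib, e1]
  simp only [ContinuousLinearMap.smul_apply, ContinuousLinearMap.add_apply,
    ContinuousLinearMap.sub_apply, ContinuousLinearMap.sum_apply, smul_eq_mul, pr,
    ContinuousLinearMap.proj_apply]
  have e2 : ∀ l, g ε j l * (D z j * dD z l v + D z l * dD z j v
      + 2 * (P z j * dM z l v + M z l * dP z j v) + 2 * (M z j * dP z l v + P z l * dM z j v))
      = D z j * (g ε j l * dD z l v) + dD z j v * (g ε j l * D z l)
      + 2 * P z j * (g ε j l * dM z l v) + 2 * dP z j v * (g ε j l * M z l)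
      + 2 * M z j * (g ε j l * dP z l v) + 2 * dM z j v * (g ε j l * P z l) := fun l => by ring
  have e3 : ∀ (x : ℂ) (y : Fin n → ℂ), ∑ l, g ε j l * x * y l = x * ∑ l, g ε j l * y l := by
    intro x y; rw [Finset.mul_sum]; exact Finset.sum_congr rfl fun l _ => by ring
  have e4 : ∀ (x : ℂ) (y : Fin n → ℂ),
      ∑ l, 1 / 2 * (g ε j l * x) * y l = 1 / 2 * x * ∑ l, g ε j l * y l := by
    intro x y; rw [Finset.mul_sum]; exact Finset.sum_congr rfl fun l _ => by ring
  simp only [e2, e3, e4, Finset.sum_add_distrib, ← Finset.mul_sum]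
  ring

theorem g_swap {n : ℕ} (ε : Fin n → ℝ) (j k : Fin n) : g ε k j = - g ε j k := by
  unfold g; rw [← neg_sub, inv_neg]

theorem g_mul {n : ℕ} (ε : Fin n → ℝ) (hε : Function.Injective ε) {j k : Fin n} (hjk : j ≠ k) :
    g ε j k * ((ε j : ℂ) - ε k) = 1 := by
  unfold g
  refine inv_mul_cancel₀ (sub_ne_zero.2 fun h => hjk (hε (by exact_mod_cast h)))

theorem g_id {n : ℕ} (ε : Fin n → ℝ) (hε : Function.Injective ε) {j k : Fin n} (hjk : j ≠ k)
    (l : Fin n) : g ε j l * g ε k l = g ε j k * (g ε k l - g ε j l)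
      + g ε j k ^ 2 * ((if j = l then 1 else 0) + (if k = l then 1 else 0)) := by
  by_cases h1 : j = l
  · subst h1
    rw [g_swap ε j k]
    rw [if_neg hjk.symm, show g ε j j = 0 by simp [g]]
    simp
    ring
  by_cases h2 : k = l
  · subst h2
    rw [if_neg h1, show g ε k k = 0 by simp [g]]
    simp
    ring
  have a1 := g_mul ε hε h1
  have a2 := g_mul ε hε h2
  have a3 := g_mul ε hε hjk
  simp only [h1, h2, if_false]
  linear_combination (-g ε j l * g ε k l) * a3 + (g ε j k * g ε k l) * a1 - (g ε j k * g ε j l) * a2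

theorem KK {n : ℕ} (ε : Fin n → ℝ) (hε : Function.Injective ε) (z : Idx n → ℂ) (j k : Fin n) :
    br (integrals ε (.inr (.inr j))) (integrals ε (.inr (.inr k))) z = 0 := by
  rw [(gK ε z j).br_eq (gK ε z k)]
  by_cases hjk : j = k
  · subst hjk
    rw [Finset.sum_eq_zero]
    · ring
    · intros; ring
  have a3 := g_mul ε hε hjk
  have hs := g_swap ε j k
  have hid := g_id ε hε hjk
  set SMj := ∑ l, g ε j l * M z l with hSMj
  set SPj := ∑ l, g ε j l * P z l with hSPj
  set SDj := ∑ l, g ε j l * D z l with hSDj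
  set SMk := ∑ l, g ε k l * M z l with hSMk
  set SPk := ∑ l, g ε k l * P z l with hSPk
  set SDk := ∑ l, g ε k l * D z l with hSDk
  obtain ⟨aj, haj⟩ : ∃ x, x = z (.inl 0) - SMj := ⟨_, rfl⟩
  obtain ⟨bj, hbj⟩ : ∃ x, x = z (.inl 1) - SPj := ⟨_, rfl⟩
  obtain ⟨cj, hcj⟩ : ∃ x, x = -(ε j : ℂ) / 2 - 1 / 2 * SDj := ⟨_, rfl⟩
  obtain ⟨ak, hak⟩ : ∃ x, x = z (.inl 0) - SMk := ⟨_, rfl⟩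
  obtain ⟨bk, hbk⟩ : ∃ x, x = z (.inl 1) - SPk := ⟨_, rfl⟩
  obtain ⟨ck, hck⟩ : ∃ x, x = -(ε k : ℂ) / 2 - 1 / 2 * SDk := ⟨_, rfl⟩
  rw [← haj, ← hbj, ← hcj, ← hak, ← hbk, ← hck]
  obtain ⟨X, hX⟩ : ∃ X : Fin n → ℂ, X = fun l => g ε k l * ((bj * M z k - aj * P z k) * D z l
      + (aj * D z k - 2 * cj * M z k) * P z l - (bj * D z k - 2 * cj * P z k) * M z l) := ⟨_, rfl⟩
  obtain ⟨Y, hY⟩ : ∃ Y : Fin n → ℂ, Y = fun l => g ε j l * ((ak * P z j - bk * M z j) * D z l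
      + (2 * ck * M z j - ak * D z j) * P z l - (2 * ck * P z j - bk * D z j) * M z l) := ⟨_, rfl⟩
  obtain ⟨Z1, hZ1⟩ : ∃ x, x = M z j * P z k - P z j * M z k := ⟨_, rfl⟩
  obtain ⟨Z2, hZ2⟩ : ∃ x, x = D z j * M z k - M z j * D z k := ⟨_, rfl⟩
  obtain ⟨Z3, hZ3⟩ : ∃ x, x = D z j * P z k - P z j * D z k := ⟨_, rfl⟩
  obtain ⟨Z, hZ⟩ : ∃ Z : Fin n → ℂ, Z = fun l => Z1 * D z l + Z2 * P z l - Z3 * M z l := ⟨_, rfl⟩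
  have key : ∀ l, _ = (if j = l then X l + g ε j k ^ 2 * Z l else 0)
      + (if k = l then Y l + g ε j k ^ 2 * Z l else 0)
      + (g ε j k * Z1 * (g ε k l * D z l) - g ε j k * Z1 * (g ε j l * D z l)
      + g ε j k * Z2 * (g ε k l * P z l) - g ε j k * Z2 * (g ε j l * P z l)
      - g ε j k * Z3 * (g ε k l * M z l) + g ε j k * Z3 * (g ε j l * M z l)) := fun l => by
    have h1 := hid l
    have : (if j = l then X l + g ε j k ^ 2 * Z l else 0)
      + (if k = l then Y l + g ε j k ^ 2 * Z l else 0)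
      + (g ε j k * Z1 * (g ε k l * D z l) - g ε j k * Z1 * (g ε j l * D z l)
      + g ε j k * Z2 * (g ε k l * P z l) - g ε j k * Z2 * (g ε j l * P z l)
      - g ε j k * Z3 * (g ε k l * M z l) + g ε j k * Z3 * (g ε j l * M z l))
      = (if j = l then X l else 0) + (if k = l then Y l else 0) + g ε j l * g ε k l * Z l := by
      rw [h1, hZ]
      split_ifs <;> ring
    exact this.symm
  have key2 : ∀ l, (((if j = l then aj else 0) - g ε j l * M z j) * ((if k = l then bk else 0) - g ε k l * P z k)
      - ((if j = l then bj else 0) - g ε j l * P z j) * ((if k = l then ak else 0) - g ε k l * M z k)) * D z l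
      + 2 * (((if j = l then cj else 0) - 1 / 2 * (g ε j l * D z j)) * ((if k = l then ak else 0) - g ε k l * M z k)
      - ((if j = l then aj else 0) - g ε j l * M z j) * ((if k = l then ck else 0) - 1 / 2 * (g ε k l * D z k))) * P z l
      - 2 * (((if j = l then cj else 0) - 1 / 2 * (g ε j l * D z j)) * ((if k = l then bk else 0) - g ε k l * P z k)
      - ((if j = l then bj else 0) - g ε j l * P z j) * ((if k = l then ck else 0) - 1 / 2 * (g ε k l * D z k))) * M z l
      = (if j = l then X l else 0) + (if k = l then Y l else 0) + g ε j l * g ε k l * Z l := fun l => by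
    rw [hX, hY, hZ, hZ1, hZ2, hZ3]
    split_ifs with h1 h2 h2
    · exact absurd (h1.trans h2.symm) hjk
    all_goals ring
  rw [Finset.sum_congr rfl fun l _ => (key2 l).trans (key l)]
  simp only [Finset.sum_add_distrib, Finset.sum_sub_distrib, ← Finset.mul_sum,
    Finset.sum_ite_eq, Finset.mem_univ, if_true]
  rw [← hSMj, ← hSPj, ← hSDj, ← hSMk, ← hSPk, ← hSDk]
  simp only [hX, hY, hZ, hZ1, hZ2, hZ3, haj, hbj, hcj, hak, hbk, hck, hs]
  linear_combination (-I * (P z j * M z k - M z j * P z k)) * a3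

theorem J0K {n : ℕ} (ε : Fin n → ℝ) (z : Idx n → ℂ) (j : Fin n) :
    br (integrals ε (.inl ())) (integrals ε (.inr (.inr j))) z = 0 := by
  rw [(gJ0 ε z).br_eq (gK ε z j)]
  have e1 : ∀ (x : ℂ) (y : Fin n → ℂ), ∑ l, (if j = l then x else 0) * y l = x * y j := by
    intro x y; simp
  have e3 : ∀ (x : ℂ) (y : Fin n → ℂ), ∑ l, g ε j l * x * y l = x * ∑ l, g ε j l * y l := by
    intro x y; rw [Finset.mul_sum]; exact Finset.sum_congr rfl fun l _ => by ring
  have e5 : ∀ x : ℂ, 2 * (1 / 2 * x) = x := fun x => by ring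
  simp only [Pi.zero_apply, zero_mul, sub_zero, zero_add, e5, sub_mul, Finset.sum_add_distrib,
    Finset.sum_sub_distrib, e1, e3]
  ring

theorem br_anti {n : ℕ} (f h : (Idx n → ℂ) → ℂ) (z : Idx n → ℂ) : br f h z = - br h f z := by
  unfold br
  simp only [Finset.sum_sub_distrib, mul_comm (pd _ f z)]
  ring

/-- the `2n+1` integrals of motion `J₀, Jⱼ, Kⱼ` pairwise
Poisson-commute with respect to the bracket `{·,·}₀`. -/
theorem integrals_in_involution
    (n : ℕ) (hn : 1 ≤ n) (ε : Fin n → ℝ) (hε : Function.Injective ε)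
    (a b : Unit ⊕ (Fin n ⊕ Fin n)) (z : Idx n → ℂ) :
    br (integrals ε a) (integrals ε b) z = 0 := by
  rcases a with ⟨⟨⟩⟩ | j | j <;> rcases b with ⟨⟨⟩⟩ | k | k
  · rw [(gJ0 ε z).br_eq (gJ0 ε z)]; simp; ring
  · rw [(gJ0 ε z).br_eq (gJ ε z k)]; simp
  · exact J0K ε z k
  · rw [(gJ ε z j).br_eq (gJ0 ε z)]; simp
  · rw [(gJ ε z j).br_eq (gJ ε z k)]; simp
  · rw [(gJ ε z j).br_eq (gK ε z k)]; simp
  · rw [br_anti, J0K, neg_zero]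
  · rw [(gK ε z j).br_eq (gJ ε z k)]; simp
  · exact KK ε hε z j k

end ThreeWaveInvolution
end

section
/- Fix n ≥ 1 and pairwise distinct complex numbers ε₁,…,εₙ. On the space with complex coordinates (h₁,…,hₙ, e₁,…,eₙ, f₁,…,fₙ), define the bracket {·,·}₀ on differentiable functions as the unique bracket of the form {F,G}₀ = Σ P⁰_{ab} ∂F/∂z_a ∂G/∂z_b with coordinate brackets {hⱼ,eⱼ}₀ = eⱼ, {hⱼ,fⱼ}₀ = −fⱼ, {eⱼ,fⱼ}₀ = 2hⱼ for each j, and all brackets between coordinates with different indices equal to zero (n copies of sl(2)). Define 𝒜(λ) = Σⱼ hⱼ/(λ−εⱼ), ℬ(λ) = 1 + Σⱼ eⱼ/(λ−εⱼ), 𝒞(λ) = Σⱼ fⱼ/(λ−εⱼ). Then for all λ ≠ μ with λ, μ ∉ {ε₁,…,εₙ}: {𝒜(λ),𝒜(μ)}₀ = {ℬ(λ),ℬ(μ)}₀ = {𝒞(λ),𝒞(μ)}₀ = 0, {𝒜(λ),ℬ(μ)}₀ = (ℬ(μ) − ℬ(λ))/(λ−μ), {𝒜(λ),𝒞(μ)}₀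 = −(𝒞(μ) − 𝒞(λ))/(λ−μ), and {ℬ(λ),𝒞(μ)}₀ = 2(𝒜(μ) − 𝒜(λ))/(λ−μ). -/
open Complex

namespace Sl2LinearBracket

/-- Index type for the coordinates `(h, e, f)`:
`.inl j = hⱼ`, `.inr (.inl j) = eⱼ`, `.inr (.inr j) = fⱼ`. -/
abbrev Idx (n : ℕ) := Fin n ⊕ (Fin n ⊕ Fin n)

/-- Partial derivative of `F` with respect to the coordinate `a` at `z`. -/
noncomputable def pd {n : ℕ} (a : Idx n) (F : (Idx n → ℂ) → ℂ) (z : Idx n → ℂ) : ℂ :=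
  fderiv ℂ F z (Pi.single a 1)

/-- The Poisson tensor of `n` copies of `sl(2)`:
`{hⱼ,eⱼ} = eⱼ`, `{hⱼ,fⱼ} = −fⱼ`, `{eⱼ,fⱼ} = 2hⱼ`, all brackets between
coordinates with different indices zero. -/
def P0 {n : ℕ} (z : Idx n → ℂ) : Idx n → Idx n → ℂ
  | .inl i, .inr (.inl j) => if i = j then z (.inr (.inl j)) else 0
  | .inr (.inl i), .inl j => if i = j then -z (.inr (.inl i)) else 0
  | .inl i, .inr (.inr j) => if i = j then -z (.inr (.inr j)) else 0
  | .inr (.inr i), .inl j => if i = j then z (.inr (.inr i)) else 0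
  | .inr (.inl i), .inr (.inr j) => if i = j then 2 * z (.inl i) else 0
  | .inr (.inr i), .inr (.inl j) => if i = j then -(2 * z (.inl i)) else 0
  | _, _ => 0

/-- The coordinate bracket `{F,G}₀ = Σ_{a,b} P⁰_{ab} ∂F/∂z_a ∂G/∂z_b`. -/
noncomputable def br {n : ℕ} (F G : (Idx n → ℂ) → ℂ) (z : Idx n → ℂ) : ℂ :=
  ∑ a : Idx n, ∑ b : Idx n, P0 z a b * pd a F z * pd b G z

/-- `𝒜(λ) = Σⱼ hⱼ/(λ−εⱼ)`. -/
noncomputable def 𝒜 {n : ℕ} (ε : Fin n → ℂ) (lam : ℂ) (z : Idx n → ℂ) : ℂ :=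
  ∑ j, z (.inl j) / (lam - ε j)

/-- `ℬ(λ) = 1 + Σⱼ eⱼ/(λ−εⱼ)`. -/
noncomputable def ℬ {n : ℕ} (ε : Fin n → ℂ) (lam : ℂ) (z : Idx n → ℂ) : ℂ :=
  1 + ∑ j, z (.inr (.inl j)) / (lam - ε j)

/-- `𝒞(λ) = Σⱼ fⱼ/(λ−εⱼ)`. -/
noncomputable def 𝒞 {n : ℕ} (ε : Fin n → ℂ) (lam : ℂ) (z : Idx n → ℂ) : ℂ :=
  ∑ j, z (.inr (.inr j)) / (lam - ε j)

lemma pd_sum {n : ℕ} (a : Idx n) (c : ℂ) (g : Fin n → Idx n) (w : Fin n → ℂ) (z : Idx n → ℂ) :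
    pd a (fun z => c + ∑ j, z (g j) / w j) z = ∑ j, (if g j = a then 1 else 0) / w j := by
  have h : HasFDerivAt (fun z : Idx n → ℂ => c + ∑ j, z (g j) / w j)
      (∑ j, (w j)⁻¹ • (ContinuousLinearMap.proj (g j) : (Idx n → ℂ) →L[ℂ] ℂ)) z := by
    refine HasFDerivAt.const_add c (HasFDerivAt.fun_sum fun j _ => ?_)
    have := ((ContinuousLinearMap.proj (g j) : (Idx n → ℂ) →L[ℂ] ℂ).hasFDerivAt (x := z)).const_mul
      (w j)⁻¹
    simpa [div_eq_inv_mul] using this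
  rw [pd, h.fderiv]
  simp [Pi.single_apply, div_eq_inv_mul]

lemma pd_A {n : ℕ} (ε : Fin n → ℂ) (l : ℂ) (a : Idx n) (z : Idx n → ℂ) :
    pd a (𝒜 ε l) z = ∑ j, (if (.inl j : Idx n) = a then 1 else 0) / (l - ε j) := by
  rw [← pd_sum a 0 (fun j => .inl j) (fun j => l - ε j) z]
  congr 1
  funext z
  simp [𝒜]

lemma pd_B {n : ℕ} (ε : Fin n → ℂ) (l : ℂ) (a : Idx n) (z : Idx n → ℂ) :
    pd a (ℬ ε l) z = ∑ j, (if (.inr (.inl j) : Idx n) = a then 1 else 0) / (l - ε j) :=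
  pd_sum a 1 (fun j => .inr (.inl j)) (fun j => l - ε j) z

lemma pd_C {n : ℕ} (ε : Fin n → ℂ) (l : ℂ) (a : Idx n) (z : Idx n → ℂ) :
    pd a (𝒞 ε l) z = ∑ j, (if (.inr (.inr j) : Idx n) = a then 1 else 0) / (l - ε j) := by
  rw [← pd_sum a 0 (fun j => .inr (.inr j)) (fun j => l - ε j) z]
  congr 1
  funext z
  simp [𝒞]

/-- for the Lax entries with simple poles, the direct sum of `n`
copies of the `sl(2)` Lie–Poisson bracket yields the linear `r`-matrix algebra. -/
theorem sl2_linear_r_matrix_algebra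
    (n : ℕ) (hn : 1 ≤ n) (ε : Fin n → ℂ) (hε : Function.Injective ε)
    (lam mu : ℂ) (hne : lam ≠ mu)
    (hlam : ∀ j, lam ≠ ε j) (hmu : ∀ j, mu ≠ ε j)
    (z : Idx n → ℂ) :
    br (𝒜 ε lam) (𝒜 ε mu) z = 0 ∧
    br (ℬ ε lam) (ℬ ε mu) z = 0 ∧
    br (𝒞 ε lam) (𝒞 ε mu) z = 0 ∧
    br (𝒜 ε lam) (ℬ ε mu) z = (ℬ ε mu z - ℬ ε lam z) / (lam - mu) ∧
    br (𝒜 ε lam) (𝒞 ε mu) z = -((𝒞 ε mu z - 𝒞 ε lam z) / (lam - mu)) ∧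
    br (ℬ ε lam) (𝒞 ε mu) z = 2 * (𝒜 ε mu z - 𝒜 ε lam z) / (lam - mu) := by
  have h0 : lam - mu ≠ 0 := sub_ne_zero.2 hne
  have h1 : ∀ j, lam - ε j ≠ 0 := fun j => sub_ne_zero.2 (hlam j)
  have h2 : ∀ j, mu - ε j ≠ 0 := fun j => sub_ne_zero.2 (hmu j)
  refine ⟨?_, ?_, ?_, ?_, ?_, ?_⟩
  · simp [br, pd_A, P0]
  · simp [br, pd_B, P0]
  · simp [br, pd_C, P0]
  · rw [eq_div_iff h0]
    simp only [ℬ, add_sub_add_left_eq_sub, ← Finset.sum_sub_distrib]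
    simp [br, pd_A, pd_B, P0, ite_div, Finset.sum_mul, -Finset.sum_sub_distrib]
    refine Finset.sum_congr rfl fun j _ => ?_
    have := h1 j
    have := h2 j
    field_simp
    ring
  · rw [← neg_div, eq_div_iff h0]
    simp only [𝒞, ← Finset.sum_sub_distrib, ← Finset.sum_neg_distrib]
    simp [br, pd_A, pd_C, P0, ite_div, Finset.sum_mul, -Finset.sum_neg_distrib, -Finset.sum_sub_distrib]
    refine Finset.sum_congr rfl fun j _ => ?_
    have := h1 j
    have := h2 j
    field_simp
    ring
  · rw [eq_div_iff h0]
    simp only [𝒜, ← Finset.sum_sub_distrib, Finset.mul_sum]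
    simp [br, pd_B, pd_C, P0, ite_div, Finset.sum_mul, -Finset.sum_sub_distrib]
    refine Finset.sum_congr rfl fun j _ => ?_
    have := h1 j
    have := h2 j
    field_simp
    ring

end Sl2LinearBracket
end

section
/- Fix n ≥ 1 and pairwise distinct complex numbers ε₁,…,εₙ. On the space with complex coordinates (h₁,…,hₙ, e₁,…,eₙ, f₁,…,fₙ), define the bracket {·,·}₁ by the coordinate brackets {hⱼ,eⱼ}₁ = (εⱼ − eⱼ)eⱼ, {hⱼ,fⱼ}₁ = −(εⱼ − eⱼ)fⱼ, {eⱼ,fⱼ}₁ = 2(εⱼ − eⱼ)hⱼ, and for i ≠ j: {h_i,e_j}₁ = −e_i e_j, {h_i,f_j}₁ = e_i f_j, {e_i,f_j}₁ = −2 e_i h_j, {f_i,f_j}₁ = −2 h_i f_j + 2 f_i h_j, {e_i,e_j}₁ = {h_i,h_j}₁ = 0. Define 𝒜(λ) = Σⱼ hⱼ/(λ−εⱼ), ℬ(λ) = 1 + Σⱼ eⱼ/(λ−εⱼ), 𝒞(λ) = Σⱼ fⱼ/(λ−εⱼ). Then for all λ ≠ μ with λ, μ ∉ {ε₁,…,εₙ}: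 {𝒜(λ),𝒜(μ)}₁ = {ℬ(λ),ℬ(μ)}₁ = 0, {𝒜(λ),ℬ(μ)}₁ = (λℬ(μ) − μℬ(λ))/(λ−μ) − ℬ(λ)ℬ(μ), {𝒜(λ),𝒞(μ)}₁ = −λ(𝒞(μ) − 𝒞(λ))/(λ−μ) + ℬ(λ)𝒞(μ), {ℬ(λ),𝒞(μ)}₁ = 2(μ𝒜(μ) − λ𝒜(λ))/(λ−μ) + 2(1 − ℬ(λ))𝒜(μ), and {𝒞(λ),𝒞(μ)}₁ = 2(𝒜(μ)𝒞(λ) − 𝒜(λ)𝒞(μ)). -/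
open Complex

namespace Sl2SecondBracket

/-- Index type for the coordinates `(h, e, f)`:
`.inl j = hⱼ`, `.inr (.inl j) = eⱼ`, `.inr (.inr j) = fⱼ`. -/
abbrev Idx (n : ℕ) := Fin n ⊕ (Fin n ⊕ Fin n)

/-- Partial derivative of `F` with respect to the coordinate `a` at `z`. -/
noncomputable def pd {n : ℕ} (a : Idx n) (F : (Idx n → ℂ) → ℂ) (z : Idx n → ℂ) : ℂ :=
  fderiv ℂ F z (Pi.single a 1)

/-- The second Poisson tensor: `{hⱼ,eⱼ}₁ = (εⱼ−eⱼ)eⱼ`, `{hⱼ,fⱼ}₁ = −(εⱼ−eⱼ)fⱼ`,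
`{eⱼ,fⱼ}₁ = 2(εⱼ−eⱼ)hⱼ`, and for `i ≠ j`: `{h_i,e_j}₁ = −e_i e_j`,
`{h_i,f_j}₁ = e_i f_j`, `{e_i,f_j}₁ = −2e_i h_j`, `{f_i,f_j}₁ = −2h_i f_j + 2f_i h_j`,
`{e_i,e_j}₁ = {h_i,h_j}₁ = 0`. -/
def P1 {n : ℕ} (ε : Fin n → ℂ) (z : Idx n → ℂ) : Idx n → Idx n → ℂ
  | .inl i, .inr (.inl j) =>
      if i = j then (ε j - z (.inr (.inl j))) * z (.inr (.inl j))
      else -(z (.inr (.inl i)) * z (.inr (.inl j)))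
  | .inr (.inl i), .inl j =>
      if i = j then -((ε i - z (.inr (.inl i))) * z (.inr (.inl i)))
      else z (.inr (.inl j)) * z (.inr (.inl i))
  | .inl i, .inr (.inr j) =>
      if i = j then -((ε j - z (.inr (.inl j))) * z (.inr (.inr j)))
      else z (.inr (.inl i)) * z (.inr (.inr j))
  | .inr (.inr i), .inl j =>
      if i = j then (ε i - z (.inr (.inl i))) * z (.inr (.inr i))
      else -(z (.inr (.inl j)) * z (.inr (.inr i)))
  | .inr (.inl i), .inr (.inr j) =>
      if i = j then 2 * (ε j - z (.inr (.inl j))) * z (.inl j)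
      else -(2 * z (.inr (.inl i)) * z (.inl j))
  | .inr (.inr i), .inr (.inl j) =>
      if i = j then -(2 * (ε i - z (.inr (.inl i))) * z (.inl i))
      else 2 * z (.inr (.inl j)) * z (.inl i)
  | .inr (.inr i), .inr (.inr j) =>
      -(2 * z (.inl i) * z (.inr (.inr j))) + 2 * z (.inr (.inr i)) * z (.inl j)
  | _, _ => 0

/-- The coordinate bracket `{F,G}₁ = Σ_{a,b} P¹_{ab} ∂F/∂z_a ∂G/∂z_b`. -/
noncomputable def br {n : ℕ} (ε : Fin n → ℂ) (F G : (Idx n → ℂ) → ℂ) (z : Idx n → ℂ) : ℂ :=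
  ∑ a : Idx n, ∑ b : Idx n, P1 ε z a b * pd a F z * pd b G z

/-- `𝒜(λ) = Σⱼ hⱼ/(λ−εⱼ)`. -/
noncomputable def 𝒜 {n : ℕ} (ε : Fin n → ℂ) (lam : ℂ) (z : Idx n → ℂ) : ℂ :=
  ∑ j, z (.inl j) / (lam - ε j)

/-- `ℬ(λ) = 1 + Σⱼ eⱼ/(λ−εⱼ)`. -/
noncomputable def ℬ {n : ℕ} (ε : Fin n → ℂ) (lam : ℂ) (z : Idx n → ℂ) : ℂ :=
  1 + ∑ j, z (.inr (.inl j)) / (lam - ε j)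

/-- `𝒞(λ) = Σⱼ fⱼ/(λ−εⱼ)`. -/
noncomputable def 𝒞 {n : ℕ} (ε : Fin n → ℂ) (lam : ℂ) (z : Idx n → ℂ) : ℂ :=
  ∑ j, z (.inr (.inr j)) / (lam - ε j)

theorem hA {n : ℕ} (ε : Fin n → ℂ) (l : ℂ) (z : Idx n → ℂ) (a : Idx n) :
    pd a (𝒜 ε l) z = ∑ j, (Pi.single a 1 : Idx n → ℂ) (.inl j) * (l - ε j)⁻¹ := by
  have h : HasFDerivAt (𝒜 ε l)
      (∑ j, (l - ε j)⁻¹ • (ContinuousLinearMap.proj (R := ℂ) (φ := fun _ : Idx n => ℂ) (.inl j))) z := by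
    unfold 𝒜
    simp only [div_eq_mul_inv]
    exact HasFDerivAt.fun_sum fun j _ => (hasFDerivAt_apply (.inl j) z).mul_const _
  unfold pd
  rw [h.fderiv]
  simp [mul_comm]

theorem hB {n : ℕ} (ε : Fin n → ℂ) (l : ℂ) (z : Idx n → ℂ) (a : Idx n) :
    pd a (ℬ ε l) z = ∑ j, (Pi.single a 1 : Idx n → ℂ) (.inr (.inl j)) * (l - ε j)⁻¹ := by
  have h : HasFDerivAt (ℬ ε l)
      (∑ j, (l - ε j)⁻¹ • (ContinuousLinearMap.proj (R := ℂ) (φ := fun _ : Idx n => ℂ) (.inr (.inl j)))) z := by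
    unfold ℬ
    simp only [div_eq_mul_inv]
    exact (HasFDerivAt.fun_sum fun j _ => (hasFDerivAt_apply (.inr (.inl j)) z).mul_const _).const_add 1
  unfold pd
  rw [h.fderiv]
  simp [mul_comm]

theorem hC {n : ℕ} (ε : Fin n → ℂ) (l : ℂ) (z : Idx n → ℂ) (a : Idx n) :
    pd a (𝒞 ε l) z = ∑ j, (Pi.single a 1 : Idx n → ℂ) (.inr (.inr j)) * (l - ε j)⁻¹ := by
  have h : HasFDerivAt (𝒞 ε l)
      (∑ j, (l - ε j)⁻¹ • (ContinuousLinearMap.proj (R := ℂ) (φ := fun _ : Idx n => ℂ) (.inr (.inr j)))) z := by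
    unfold 𝒞
    simp only [div_eq_mul_inv]
    exact HasFDerivAt.fun_sum fun j _ => (hasFDerivAt_apply (.inr (.inr j)) z).mul_const _
  unfold pd
  rw [h.fderiv]
  simp [mul_comm]

theorem key {n : ℕ} (ε x : Fin n → ℂ) (l m : ℂ) (hne : l ≠ m)
    (hl : ∀ j, l ≠ ε j) (hm : ∀ j, m ≠ ε j) :
    ∑ j, ε j * x j * (l - ε j)⁻¹ * (m - ε j)⁻¹ =
      (m * (∑ j, x j / (m - ε j)) - l * ∑ j, x j / (l - ε j)) / (l - m) := by
  rw [Finset.mul_sum, Finset.mul_sum, ← Finset.sum_sub_distrib, Finset.sum_div]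
  refine Finset.sum_congr rfl fun j _ => ?_
  have h1 := sub_ne_zero.2 (hl j)
  have h2 := sub_ne_zero.2 (hm j)
  have h3 := sub_ne_zero.2 hne
  field_simp
  ring

theorem dsum {n : ℕ} (ε x u v : Fin n → ℂ) (l m c d : ℂ) (Q : Fin n → Fin n → ℂ)
    (hQ : ∀ i j, Q i j = (if i = j then c * (ε j * x j) else 0) + d * (u i * v j)) :
    ∑ i, ∑ j, Q i j * (l - ε i)⁻¹ * (m - ε j)⁻¹ =
      c * (∑ j, ε j * x j * (l - ε j)⁻¹ * (m - ε j)⁻¹) +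
      d * ((∑ j, u j / (l - ε j)) * ∑ j, v j / (m - ε j)) := by
  rw [Finset.sum_mul_sum, Finset.mul_sum, Finset.mul_sum, ← Finset.sum_add_distrib]
  refine Finset.sum_congr rfl fun i _ => ?_
  simp only [hQ, add_mul, Finset.sum_add_distrib, ite_mul, zero_mul, Finset.sum_ite_eq,
    Finset.mem_univ, if_true, Finset.mul_sum]
  congr 1
  · ring
  · exact Finset.sum_congr rfl fun j _ => by ring

/-- the second bracket `{·,·}₁` of the Lax entries `𝒜, ℬ, 𝒞`. -/
theorem sl2_second_bracket_relations
    (n : ℕ) (hn : 1 ≤ n) (ε : Fin n → ℂ) (hε : Function.Injective ε)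
    (lam mu : ℂ) (hne : lam ≠ mu)
    (hlam : ∀ j, lam ≠ ε j) (hmu : ∀ j, mu ≠ ε j)
    (z : Idx n → ℂ) :
    br ε (𝒜 ε lam) (𝒜 ε mu) z = 0 ∧
    br ε (ℬ ε lam) (ℬ ε mu) z = 0 ∧
    br ε (𝒜 ε lam) (ℬ ε mu) z
      = (lam * ℬ ε mu z - mu * ℬ ε lam z) / (lam - mu) - ℬ ε lam z * ℬ ε mu z ∧
    br ε (𝒜 ε lam) (𝒞 ε mu) z
      = -(lam * (𝒞 ε mu z - 𝒞 ε lam z) / (lam - mu)) + ℬ ε lam z * 𝒞 ε mu z ∧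
    br ε (ℬ ε lam) (𝒞 ε mu) z
      = 2 * (mu * 𝒜 ε mu z - lam * 𝒜 ε lam z) / (lam - mu)
        + 2 * (1 - ℬ ε lam z) * 𝒜 ε mu z ∧
    br ε (𝒞 ε lam) (𝒞 ε mu) z
      = 2 * (𝒜 ε mu z * 𝒞 ε lam z - 𝒜 ε lam z * 𝒞 ε mu z) := by
  have h3 := sub_ne_zero.2 hne
  refine ⟨?_, ?_, ?_, ?_, ?_, ?_⟩
  · simp [br, hA, P1, Fintype.sum_sum_type, Pi.single_apply]
  · simp [br, hB, P1, Fintype.sum_sum_type, Pi.single_apply]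
  · have : br ε (𝒜 ε lam) (ℬ ε mu) z = ∑ i, ∑ j, P1 ε z (.inl i) (.inr (.inl j)) *
        (lam - ε i)⁻¹ * (mu - ε j)⁻¹ := by
      simp [br, hA, hB, Fintype.sum_sum_type, Pi.single_apply]
    rw [this, dsum ε (fun j => z (.inr (.inl j))) (fun j => z (.inr (.inl j)))
      (fun j => z (.inr (.inl j))) lam mu 1 (-1), key ε _ lam mu hne hlam hmu]
    · unfold ℬ
      field_simp
      ring
    · intro i j
      by_cases h : i = j
      · subst h; simp [P1]; ring
      · simp [P1, h]
  · have : br ε (𝒜 ε lam) (𝒞 ε mu) z = ∑ i, ∑ j, P1 ε z (.inl i) (.inr (.inr j)) *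
        (lam - ε i)⁻¹ * (mu - ε j)⁻¹ := by
      simp [br, hA, hC, Fintype.sum_sum_type, Pi.single_apply]
    rw [this, dsum ε (fun j => z (.inr (.inr j))) (fun j => z (.inr (.inl j)))
      (fun j => z (.inr (.inr j))) lam mu (-1) 1, key ε _ lam mu hne hlam hmu]
    · unfold ℬ 𝒞
      field_simp
      ring
    · intro i j
      by_cases h : i = j
      · subst h; simp [P1]; ring
      · simp [P1, h]
  · have : br ε (ℬ ε lam) (𝒞 ε mu) z = ∑ i, ∑ j, P1 ε z (.inr (.inl i)) (.inr (.inr j)) *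
        (lam - ε i)⁻¹ * (mu - ε j)⁻¹ := by
      simp [br, hB, hC, Fintype.sum_sum_type, Pi.single_apply]
    rw [this, dsum ε (fun j => z (.inl j)) (fun j => z (.inr (.inl j)))
      (fun j => z (.inl j)) lam mu 2 (-2), key ε _ lam mu hne hlam hmu]
    · unfold ℬ 𝒜
      field_simp
      ring
    · intro i j
      by_cases h : i = j
      · subst h; simp [P1]; ring
      · simp [P1, h]; ring
  · have : br ε (𝒞 ε lam) (𝒞 ε mu) z = ∑ i, ∑ j, P1 ε z (.inr (.inr i)) (.inr (.inr j)) *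
        (lam - ε i)⁻¹ * (mu - ε j)⁻¹ := by
      simp [br, hC, Fintype.sum_sum_type, Pi.single_apply]
    rw [this]
    unfold 𝒜 𝒞
    rw [mul_comm (∑ j, z (.inl j) / (mu - ε j)), Finset.sum_mul_sum, Finset.sum_mul_sum,
      ← Finset.sum_sub_distrib, Finset.mul_sum]
    refine Finset.sum_congr rfl fun i _ => ?_
    rw [← Finset.sum_sub_distrib, Finset.mul_sum]
    refine Finset.sum_congr rfl fun j _ => ?_
    simp only [P1]
    ring


end Sl2SecondBracket
end

section
/- Fix n ≥ 1 and complex numbers ε₁,…,εₙ. On ℂ^{3n} with coordinates (h₁,…,hₙ, e₁,…,eₙ, f₁,…,fₙ), let P₀ be the antisymmetric bivector matrix given by the coordinate brackets {hⱼ,eⱼ}₀ = eⱼ, {hⱼ,fⱼ}₀ = −fⱼ, {eⱼ,fⱼ}₀ = 2hⱼ (all brackets between different indices zero), and let P₁ be the antisymmetric bivector matrix given by {hⱼ,eⱼ}₁ = (εⱼ − eⱼ)eⱼ, {hⱼ,fⱼ}₁ = −(εⱼ − eⱼ)fⱼ, {eⱼ,fⱼ}₁ = 2(εⱼ − eⱼ)hⱼ,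 and for i ≠ j: {h_i,e_j}₁ = −e_i e_j, {h_i,f_j}₁ = e_i f_j, {e_i,f_j}₁ = −2 e_i h_j, {f_i,f_j}₁ = −2 h_i f_j + 2 f_i h_j, {e_i,e_j}₁ = {h_i,h_j}₁ = 0. Then P₀ and P₁ are compatible Poisson structures: for every α, β ∈ ℂ the bracket associated with αP₀ + βP₁ satisfies the Jacobi identity, i.e., Σ_m [(αP₀+βP₁)^{mk} ∂(αP₀+βP₁)^{ij}/∂z_m + cyclic permutations of (i,j,k)] = 0 for all indices i, j, k. -/
open Complex

namespace Sl2Compatibility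

/-- Index type for the coordinates `(h, e, f)` on `ℂ^{3n}`:
`.inl j = hⱼ`, `.inr (.inl j) = eⱼ`, `.inr (.inr j) = fⱼ`. -/
abbrev Idx (n : ℕ) := Fin n ⊕ (Fin n ⊕ Fin n)

/-- Partial derivative of `F` with respect to the coordinate `a` at `z`. -/
noncomputable def pd {n : ℕ} (a : Idx n) (F : (Idx n → ℂ) → ℂ) (z : Idx n → ℂ) : ℂ :=
  fderiv ℂ F z (Pi.single a 1)

/-- The first Poisson tensor `P₀` (n copies of `sl(2)`): `{hⱼ,eⱼ}₀ = eⱼ`,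
`{hⱼ,fⱼ}₀ = −fⱼ`, `{eⱼ,fⱼ}₀ = 2hⱼ`, brackets between different indices zero. -/
def P0 {n : ℕ} (z : Idx n → ℂ) : Idx n → Idx n → ℂ
  | .inl i, .inr (.inl j) => if i = j then z (.inr (.inl j)) else 0
  | .inr (.inl i), .inl j => if i = j then -z (.inr (.inl i)) else 0
  | .inl i, .inr (.inr j) => if i = j then -z (.inr (.inr j)) else 0
  | .inr (.inr i), .inl j => if i = j then z (.inr (.inr i)) else 0
  | .inr (.inl i), .inr (.inr j) => if i = j then 2 * z (.inl i) else 0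
  | .inr (.inr i), .inr (.inl j) => if i = j then -(2 * z (.inl i)) else 0
  | _, _ => 0

/-- The second Poisson tensor `P₁`: `{hⱼ,eⱼ}₁ = (εⱼ−eⱼ)eⱼ`, `{hⱼ,fⱼ}₁ = −(εⱼ−eⱼ)fⱼ`,
`{eⱼ,fⱼ}₁ = 2(εⱼ−eⱼ)hⱼ`, and for `i ≠ j`: `{h_i,e_j}₁ = −e_i e_j`,
`{h_i,f_j}₁ = e_i f_j`, `{e_i,f_j}₁ = −2e_i h_j`, `{f_i,f_j}₁ = −2h_i f_j + 2f_i h_j`,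
`{e_i,e_j}₁ = {h_i,h_j}₁ = 0`. -/
def P1 {n : ℕ} (ε : Fin n → ℂ) (z : Idx n → ℂ) : Idx n → Idx n → ℂ
  | .inl i, .inr (.inl j) =>
      if i = j then (ε j - z (.inr (.inl j))) * z (.inr (.inl j))
      else -(z (.inr (.inl i)) * z (.inr (.inl j)))
  | .inr (.inl i), .inl j =>
      if i = j then -((ε i - z (.inr (.inl i))) * z (.inr (.inl i)))
      else z (.inr (.inl j)) * z (.inr (.inl i))
  | .inl i, .inr (.inr j) =>
      if i = j then -((ε j - z (.inr (.inl j))) * z (.inr (.inr j)))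
      else z (.inr (.inl i)) * z (.inr (.inr j))
  | .inr (.inr i), .inl j =>
      if i = j then (ε i - z (.inr (.inl i))) * z (.inr (.inr i))
      else -(z (.inr (.inl j)) * z (.inr (.inr i)))
  | .inr (.inl i), .inr (.inr j) =>
      if i = j then 2 * (ε j - z (.inr (.inl j))) * z (.inl j)
      else -(2 * z (.inr (.inl i)) * z (.inl j))
  | .inr (.inr i), .inr (.inl j) =>
      if i = j then -(2 * (ε i - z (.inr (.inl i))) * z (.inl i))
      else 2 * z (.inr (.inl j)) * z (.inl i)
  | .inr (.inr i), .inr (.inr j) =>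
      -(2 * z (.inl i) * z (.inr (.inr j))) + 2 * z (.inr (.inr i)) * z (.inl j)
  | _, _ => 0

/-- Uniform form of the pencil. -/
def PP {n : ℕ} (c : Fin n → ℂ) (β : ℂ) (z : Idx n → ℂ) : Idx n → Idx n → ℂ
  | .inl i, .inr (.inl j) => (if i = j then c i else 0) * z (.inr (.inl j))
      - β * (z (.inr (.inl i)) * z (.inr (.inl j)))
  | .inr (.inl i), .inl j => -(if i = j then c i else 0) * z (.inr (.inl i))
      + β * (z (.inr (.inl j)) * z (.inr (.inl i)))
  | .inl i, .inr (.inr j) => -(if i = j then c i else 0) * z (.inr (.inr j))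
      + β * (z (.inr (.inl i)) * z (.inr (.inr j)))
  | .inr (.inr i), .inl j => (if i = j then c i else 0) * z (.inr (.inr i))
      - β * (z (.inr (.inl j)) * z (.inr (.inr i)))
  | .inr (.inl i), .inr (.inr j) => 2 * (if i = j then c i else 0) * z (.inl j)
      - 2 * β * (z (.inr (.inl i)) * z (.inl j))
  | .inr (.inr i), .inr (.inl j) => -2 * (if i = j then c i else 0) * z (.inl i)
      + 2 * β * (z (.inr (.inl j)) * z (.inl i))
  | .inr (.inr i), .inr (.inr j) =>
      -2 * β * (z (.inl i) * z (.inr (.inr j))) + 2 * β * (z (.inr (.inr i)) * z (.inl j))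
  | _, _ => 0

/-- Its differential. -/
def DP {n : ℕ} (c : Fin n → ℂ) (β : ℂ) (z v : Idx n → ℂ) : Idx n → Idx n → ℂ
  | .inl i, .inr (.inl j) => (if i = j then c i else 0) * v (.inr (.inl j))
      - β * (z (.inr (.inl i)) * v (.inr (.inl j)) + z (.inr (.inl j)) * v (.inr (.inl i)))
  | .inr (.inl i), .inl j => -(if i = j then c i else 0) * v (.inr (.inl i))
      + β * (z (.inr (.inl j)) * v (.inr (.inl i)) + z (.inr (.inl i)) * v (.inr (.inl j)))
  | .inl i, .inr (.inr j) => -(if i = j then c i else 0) * v (.inr (.inr j))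
      + β * (z (.inr (.inl i)) * v (.inr (.inr j)) + z (.inr (.inr j)) * v (.inr (.inl i)))
  | .inr (.inr i), .inl j => (if i = j then c i else 0) * v (.inr (.inr i))
      - β * (z (.inr (.inl j)) * v (.inr (.inr i)) + z (.inr (.inr i)) * v (.inr (.inl j)))
  | .inr (.inl i), .inr (.inr j) => 2 * (if i = j then c i else 0) * v (.inl j)
      - 2 * β * (z (.inr (.inl i)) * v (.inl j) + z (.inl j) * v (.inr (.inl i)))
  | .inr (.inr i), .inr (.inl j) => -2 * (if i = j then c i else 0) * v (.inl i)
      + 2 * β * (z (.inr (.inl j)) * v (.inl i) + z (.inl i) * v (.inr (.inl j)))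
  | .inr (.inr i), .inr (.inr j) =>
      -2 * β * (z (.inl i) * v (.inr (.inr j)) + z (.inr (.inr j)) * v (.inl i))
      + 2 * β * (z (.inr (.inr i)) * v (.inl j) + z (.inl j) * v (.inr (.inr i)))
  | _, _ => 0

theorem PP_eq {n : ℕ} (ε : Fin n → ℂ) (α β : ℂ) (w : Idx n → ℂ) (a b : Idx n) :
    α * P0 w a b + β * P1 ε w a b = PP (fun i => α + β * ε i) β w a b := by
  rcases a with a | a | a <;> rcases b with b | b | b <;> simp only [P0, P1, PP] <;>
    (by_cases h : a = b
     · subst h; (try simp only [if_true]); ring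
     · (try simp only [if_neg h]); ring)

theorem coord_hasFDerivAt {n : ℕ} (z : Idx n → ℂ) (a : Idx n) :
    HasFDerivAt (fun w : Idx n → ℂ => w a) (ContinuousLinearMap.proj (R := ℂ) a) z :=
  (ContinuousLinearMap.proj (R := ℂ) (φ := fun _ : Idx n => ℂ) a).hasFDerivAt

theorem fderiv_quad {n : ℕ} (z v : Idx n → ℂ) (A B C : ℂ) (p q r s t : Idx n) :
    fderiv ℂ (fun w : Idx n → ℂ => A * w p + B * (w q * w r) + C * (w s * w t)) z v
      = A * v p + B * (z q * v r + z r * v q) + C * (z s * v t + z t * v s) := by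
  have h := (((coord_hasFDerivAt z p).const_mul A).add
    (((coord_hasFDerivAt z q).mul (coord_hasFDerivAt z r)).const_mul B)).add
    (((coord_hasFDerivAt z s).mul (coord_hasFDerivAt z t)).const_mul C)
  have h2 := congrArg (fun L => L v) h.fderiv
  refine Eq.trans h2 ?_
  simp
  ring

theorem fderiv_of {n : ℕ} {F : (Idx n → ℂ) → ℂ} {z v : Idx n → ℂ} {y : ℂ} (A B C : ℂ)
    (p q r s t : Idx n)
    (h : ∀ w, F w = A * w p + B * (w q * w r) + C * (w s * w t))
    (hy : A * v p + B * (z q * v r + z r * v q) + C * (z s * v t + z t * v s) = y) :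
    fderiv ℂ F z v = y := by
  rw [funext h, fderiv_quad, hy]

theorem fderiv_PP {n : ℕ} (c : Fin n → ℂ) (β : ℂ) (z v : Idx n → ℂ) (a b : Idx n) :
    fderiv ℂ (fun w => PP c β w a b) z v = DP c β z v a b := by
  rcases a with i | i | i <;> rcases b with j | j | j <;> simp only [PP, DP]
  · simp
  · apply fderiv_of (if i = j then c i else 0) (-β) 0 (.inr (.inl j)) (.inr (.inl i))
      (.inr (.inl j)) (.inl i) (.inl i) <;> intros <;> ring
  · apply fderiv_of (-(if i = j then c i else 0)) β 0 (.inr (.inr j)) (.inr (.inl i))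
      (.inr (.inr j)) (.inl i) (.inl i) <;> intros <;> ring
  · apply fderiv_of (-(if i = j then c i else 0)) β 0 (.inr (.inl i)) (.inr (.inl j))
      (.inr (.inl i)) (.inl i) (.inl i) <;> intros <;> ring
  · simp
  · apply fderiv_of (2 * (if i = j then c i else 0)) (-2 * β) 0 (.inl j) (.inr (.inl i))
      (.inl j) (.inl i) (.inl i) <;> intros <;> ring
  · apply fderiv_of (if i = j then c i else 0) (-β) 0 (.inr (.inr i)) (.inr (.inl j))
      (.inr (.inr i)) (.inl i) (.inl i) <;> intros <;> ring
  · apply fderiv_of (-2 * (if i = j then c i else 0)) (2 * β) 0 (.inl i) (.inr (.inl j))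
      (.inl i) (.inl i) (.inl i) <;> intros <;> ring
  · apply fderiv_of 0 (-2 * β) (2 * β) (.inl i) (.inl i) (.inr (.inr j)) (.inr (.inr i))
      (.inl j) <;> intros <;> ring

theorem sum_pd {n : ℕ} (F : (Idx n → ℂ) → ℂ) (z v : Idx n → ℂ) :
    ∑ m : Idx n, v m * pd m F z = fderiv ℂ F z v := by
  conv_rhs => rw [pi_eq_sum_univ' v]
  rw [map_sum]
  refine Finset.sum_congr rfl fun m _ => ?_
  rw [map_smul, smul_eq_mul, pd]

theorem jacobi_PP {n : ℕ} (c : Fin n → ℂ) (β : ℂ) (z : Idx n → ℂ) (a b d : Idx n) :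
    DP c β z (fun m => PP c β z m d) a b + DP c β z (fun m => PP c β z m a) b d
      + DP c β z (fun m => PP c β z m b) d a = 0 := by
  rcases a with i | i | i <;> rcases b with j | j | j <;> rcases d with k | k | k <;>
    simp only [PP, DP] <;>
    (by_cases hij : i = j
     · subst hij
       by_cases hik : i = k
       · subst hik; (try simp only [if_true]); ring
       · (try simp only [if_true, if_neg hik, if_neg (Ne.symm hik)]); ring
     · by_cases hik : i = k
       · subst hik; (try simp only [if_true, if_neg hij, if_neg (Ne.symm hij)]); ring
       · by_cases hjk : j = k
         · subst hjk; (try simp only [if_true, if_neg hij, if_neg (Ne.symm hij)]); ring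
         · (try simp only [if_neg hij, if_neg (Ne.symm hij), if_neg hik, if_neg (Ne.symm hik),
             if_neg hjk, if_neg (Ne.symm hjk)])
           ring)

/-- `P₀` and `P₁` are compatible Poisson structures: every linear
combination `αP₀ + βP₁` satisfies the Jacobi identity (vanishing of the Schouten
bracket `[[αP₀+βP₁, αP₀+βP₁]]`). -/
theorem P0_P1_compatible_Poisson
    (n : ℕ) (hn : 1 ≤ n) (ε : Fin n → ℂ) (α β : ℂ) (z : Idx n → ℂ)
    (i j k : Idx n) :
    let P : (Idx n → ℂ) → Idx n → Idx n → ℂ := fun w a b => α * P0 w a b + β * P1 ε w a b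
    ∑ m : Idx n,
      (P z m k * pd m (fun w => P w i j) z
        + P z m i * pd m (fun w => P w j k) z
        + P z m j * pd m (fun w => P w k i) z) = 0 := by
  intro P
  have hP : P = fun w a b => PP (fun i => α + β * ε i) β w a b := by
    funext w a b
    exact PP_eq ε α β w a b
  rw [hP]
  simp only [Finset.sum_add_distrib]
  rw [sum_pd _ z (fun m => PP (fun i => α + β * ε i) β z m k),
    sum_pd _ z (fun m => PP (fun i => α + β * ε i) β z m i),
    sum_pd _ z (fun m => PP (fun i => α + β * ε i) β z m j),
    fderiv_PP, fderiv_PP, fderiv_PP]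
  exact jacobi_PP _ _ _ _ _ _

end Sl2Compatibility
end

section
/- Let ε ∈ ℝ with ε² = 1, and let A₁, A₂, A₃ : ℝ → ℂ be differentiable functions satisfying the three-wave system i·A₁' = ε·A₃·conj(A₂), i·A₂' = ε·conj(A₁)·A₃, i·A₃' = ε·A₁·A₂. Then for every λ ∈ ℂ with λ ≠ 0, the matrices L(ξ,λ) = [[−iλ/2 + (i/2λ)·𝒜, −iε·A₁ − (i/λ)·A₃·conj(A₂)],[−iε·conj(A₁) − (i/λ)·A₂·conj(A₃), iλ/2 − (i/2λ)·𝒜]] and M(ξ,λ) = [[−iλ/2, −iε·A₁],[−iε·conj(A₁), iλ/2]], where 𝒜 = |A₂|² − |A₃|², satisfy the Lax equation dL/dξ = M·L − L·M. -/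
open Complex Matrix

/-- Lax pair for the three wave system. -/
theorem lax_pair_three_wave
    (ε : ℝ) (hε : ε ^ 2 = 1)
    (A₁ A₂ A₃ : ℝ → ℂ)
    (h₁ : Differentiable ℝ A₁) (h₂ : Differentiable ℝ A₂) (h₃ : Differentiable ℝ A₃)
    (eq₁ : ∀ ξ, I * deriv A₁ ξ = (ε : ℂ) * A₃ ξ * star (A₂ ξ))
    (eq₂ : ∀ ξ, I * deriv A₂ ξ = (ε : ℂ) * star (A₁ ξ) * A₃ ξ)
    (eq₃ : ∀ ξ, I * deriv A₃ ξ = (ε : ℂ) * A₁ ξ * A₂ ξ)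
    (lam : ℂ) (hlam : lam ≠ 0) :
    let 𝒜 : ℝ → ℂ := fun ξ => A₂ ξ * star (A₂ ξ) - A₃ ξ * star (A₃ ξ)
    let L : ℝ → Matrix (Fin 2) (Fin 2) ℂ := fun ξ =>
      !![-I * lam / 2 + I / (2 * lam) * 𝒜 ξ,
          -I * (ε : ℂ) * A₁ ξ - I / lam * (A₃ ξ * star (A₂ ξ));
          -I * (ε : ℂ) * star (A₁ ξ) - I / lam * (A₂ ξ * star (A₃ ξ)),
          I * lam / 2 - I / (2 * lam) * 𝒜 ξ]
    let M : ℝ → Matrix (Fin 2) (Fin 2) ℂ := fun ξ =>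
      !![-I * lam / 2, -I * (ε : ℂ) * A₁ ξ;
          -I * (ε : ℂ) * star (A₁ ξ), I * lam / 2]
    ∀ ξ : ℝ, ∀ i k : Fin 2,
      HasDerivAt (fun t => L t i k) ((M ξ * L ξ - L ξ * M ξ) i k) ξ := by
  intro 𝒜 L M ξ
  have hε' : (ε : ℂ) ^ 2 = 1 := by exact_mod_cast hε
  have key : ∀ x y : ℂ, I * x = y → x = -I * y := by
    intro x y h
    rw [← h]
    linear_combination x * I_sq
  have d₁ : HasDerivAt A₁ (-I * ((ε : ℂ) * A₃ ξ * star (A₂ ξ))) ξ := by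
    rw [← key _ _ (eq₁ ξ)]; exact (h₁ ξ).hasDerivAt
  have d₂ : HasDerivAt A₂ (-I * ((ε : ℂ) * star (A₁ ξ) * A₃ ξ)) ξ := by
    rw [← key _ _ (eq₂ ξ)]; exact (h₂ ξ).hasDerivAt
  have d₃ : HasDerivAt A₃ (-I * ((ε : ℂ) * A₁ ξ * A₂ ξ)) ξ := by
    rw [← key _ _ (eq₃ ξ)]; exact (h₃ ξ).hasDerivAt
  have s₁ : HasDerivAt (fun t => star (A₁ t)) (I * ((ε : ℂ) * star (A₃ ξ) * A₂ ξ)) ξ := by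
    refine HasDerivAt.congr_deriv d₁.star ?_
    simp
  have s₂ : HasDerivAt (fun t => star (A₂ t)) (I * ((ε : ℂ) * A₁ ξ * star (A₃ ξ))) ξ := by
    refine HasDerivAt.congr_deriv d₂.star ?_
    simp
  have s₃ : HasDerivAt (fun t => star (A₃ t)) (I * ((ε : ℂ) * star (A₁ ξ) * star (A₂ ξ))) ξ := by
    refine HasDerivAt.congr_deriv d₃.star ?_
    simp
  have dA := (d₂.mul s₂).sub (d₃.mul s₃)
  have e11 := (dA.const_mul (I / (2 * lam))).const_add (-I * lam / 2)
  have e22 := (dA.const_mul (I / (2 * lam))).const_sub (I * lam / 2)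
  have e12 := (d₁.const_mul (-I * (ε : ℂ))).sub ((d₃.mul s₂).const_mul (I / lam))
  have e21 := (s₁.const_mul (-I * (ε : ℂ))).sub ((d₂.mul s₃).const_mul (I / lam))
  intro i k
  fin_cases i <;> fin_cases k
  · refine HasDerivAt.congr_deriv (f := fun t => L t 0 0) e11 ?_
    simp only [L, M, 𝒜, Matrix.sub_apply, Matrix.mul_apply, Fin.sum_univ_two]
    simp
    field_simp
    ring_nf
  · refine HasDerivAt.congr_deriv (f := fun t => L t 0 1) e12 ?_
    simp only [L, M, 𝒜, Matrix.sub_apply, Matrix.mul_apply, Fin.sum_univ_two]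
    simp
    field_simp
    ring_nf
    simp [hε']
    try ring
  · refine HasDerivAt.congr_deriv (f := fun t => L t 1 0) e21 ?_
    simp only [L, M, 𝒜, Matrix.sub_apply, Matrix.mul_apply, Fin.sum_univ_two]
    simp
    field_simp
    ring_nf
    simp [hε']
    try ring
  · refine HasDerivAt.congr_deriv (f := fun t => L t 1 1) e22 ?_
    simp only [L, M, 𝒜, Matrix.sub_apply, Matrix.mul_apply, Fin.sum_univ_two]
    simp
    field_simp
    ring_nf
end

section
/- Let ε ∈ ℝ and let A₁, A₂, A₃ : ℝ → ℂ be differentiable functions satisfying the three-wave system i·A₁' = ε·A₃·conj(A₂), i·A₂' = ε·conj(A₁)·A₃, i·A₃' = ε·A₁·A₂. Then the quantities N = |A₁|² − (|A₂|² − |A₃|²)/2 and H = A₁·A₂·conj(A₃) + conj(A₁)·conj(A₂)·A₃ are constant in ξ. -/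
open Complex

/-- the quantities `N = |A₁|² − (|A₂|² − |A₃|²)/2` and
`H = A₁A₂·conj(A₃) + conj(A₁)conj(A₂)·A₃` are conserved by the three wave system. -/
theorem three_wave_N_H_conserved
    (ε : ℝ)
    (A₁ A₂ A₃ : ℝ → ℂ)
    (h₁ : Differentiable ℝ A₁) (h₂ : Differentiable ℝ A₂) (h₃ : Differentiable ℝ A₃)
    (eq₁ : ∀ ξ, I * deriv A₁ ξ = (ε : ℂ) * A₃ ξ * star (A₂ ξ))
    (eq₂ : ∀ ξ, I * deriv A₂ ξ = (ε : ℂ) * star (A₁ ξ) * A₃ ξ)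
    (eq₃ : ∀ ξ, I * deriv A₃ ξ = (ε : ℂ) * A₁ ξ * A₂ ξ) :
    let N : ℝ → ℂ := fun ξ => A₁ ξ * star (A₁ ξ)
      - (A₂ ξ * star (A₂ ξ) - A₃ ξ * star (A₃ ξ)) / 2
    let H : ℝ → ℂ := fun ξ => A₁ ξ * A₂ ξ * star (A₃ ξ)
      + star (A₁ ξ) * star (A₂ ξ) * A₃ ξ
    (∀ ξ₁ ξ₂ : ℝ, N ξ₁ = N ξ₂) ∧ (∀ ξ₁ ξ₂ : ℝ, H ξ₁ = H ξ₂) := by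
  intro N H
  have solve : ∀ x y : ℂ, I * x = y → x = -I * y := by
    intro x y h
    rw [← h, ← mul_assoc]
    simp
  have d₁ : ∀ ξ, HasDerivAt A₁ (-I * ((ε : ℂ) * A₃ ξ * star (A₂ ξ))) ξ := fun ξ => by
    rw [← solve _ _ (eq₁ ξ)]; exact (h₁ ξ).hasDerivAt
  have d₂ : ∀ ξ, HasDerivAt A₂ (-I * ((ε : ℂ) * star (A₁ ξ) * A₃ ξ)) ξ := fun ξ => by
    rw [← solve _ _ (eq₂ ξ)]; exact (h₂ ξ).hasDerivAt
  have d₃ : ∀ ξ, HasDerivAt A₃ (-I * ((ε : ℂ) * A₁ ξ * A₂ ξ)) ξ := fun ξ => by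
    rw [← solve _ _ (eq₃ ξ)]; exact (h₃ ξ).hasDerivAt
  have key : ∀ F : ℝ → ℂ, (∀ ξ, HasDerivAt F 0 ξ) → ∀ a b, F a = F b := fun F hF =>
    is_const_of_deriv_eq_zero (fun ξ => (hF ξ).differentiableAt) (fun ξ => (hF ξ).deriv)
  refine ⟨key N fun ξ => ?_, key H fun ξ => ?_⟩
  · have h := ((d₁ ξ).mul (d₁ ξ).star).sub
      ((((d₂ ξ).mul (d₂ ξ).star).sub ((d₃ ξ).mul (d₃ ξ).star)).div_const 2)
    refine HasDerivAt.congr_deriv h ?_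
    simp
    ring
  · have h := (((d₁ ξ).mul (d₂ ξ)).mul (d₃ ξ).star).add
      (((d₁ ξ).star.mul (d₂ ξ).star).mul (d₃ ξ))
    refine HasDerivAt.congr_deriv h ?_
    simp
    ring
end

section
/- Let ε ∈ ℝ with ε² = 1, and let A₁, A₂, A₃ : ℝ → ℂ be differentiable functions satisfying the three-wave system i·A₁' = ε·A₃·conj(A₂), i·A₂' = ε·conj(A₁)·A₃, i·A₃' = ε·A₁·A₂. Set ν(ξ) = |A₁(ξ)|² and H = A₁·A₂·conj(A₃) + conj(A₁)·conj(A₂)·A₃ (a conserved real quantity). Then for every ξ, (dν/dξ)² = 4·|A₁|²·|A₂|²·|A₃|² − H². -/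
open Complex

/-- for solutions of the three wave system with `ε² = 1`, the squared
modulus `ν = |A₁|²` satisfies `(dν/dξ)² = 4|A₁|²|A₂|²|A₃|² − H²`. -/
theorem three_wave_nu_equation
    (ε : ℝ) (hε : ε ^ 2 = 1)
    (A₁ A₂ A₃ : ℝ → ℂ)
    (h₁ : Differentiable ℝ A₁) (h₂ : Differentiable ℝ A₂) (h₃ : Differentiable ℝ A₃)
    (eq₁ : ∀ ξ, I * deriv A₁ ξ = (ε : ℂ) * A₃ ξ * star (A₂ ξ))
    (eq₂ : ∀ ξ, I * deriv A₂ ξ = (ε : ℂ) * star (A₁ ξ) * A₃ ξ)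
    (eq₃ : ∀ ξ, I * deriv A₃ ξ = (ε : ℂ) * A₁ ξ * A₂ ξ) :
    let ν : ℝ → ℂ := fun ξ => A₁ ξ * star (A₁ ξ)
    let H : ℝ → ℂ := fun ξ => A₁ ξ * A₂ ξ * star (A₃ ξ)
      + star (A₁ ξ) * star (A₂ ξ) * A₃ ξ
    ∀ ξ : ℝ, (deriv ν ξ) ^ 2
      = 4 * (A₁ ξ * star (A₁ ξ)) * (A₂ ξ * star (A₂ ξ)) * (A₃ ξ * star (A₃ ξ))
        - H ξ ^ 2 := by
  intro ν H ξ
  have d1 : deriv A₁ ξ = -I * ((ε : ℂ) * A₃ ξ * star (A₂ ξ)) := by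
    rw [← eq₁ ξ, ← mul_assoc, neg_mul, I_mul_I]; ring
  have hd := (h₁ ξ).hasDerivAt
  have hν : deriv ν ξ = deriv A₁ ξ * star (A₁ ξ) + A₁ ξ * star (deriv A₁ ξ) :=
    (hd.mul hd.star).deriv
  have d2 : star (deriv A₁ ξ) = I * ((ε : ℂ) * star (A₃ ξ) * A₂ ξ) := by
    rw [d1]; simp
  have hε' : (ε : ℂ) ^ 2 = 1 := by exact_mod_cast hε
  rw [hν, d2, d1]
  simp only [H]
  generalize star (A₁ ξ) = b1
  generalize star (A₂ ξ) = b2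
  generalize star (A₃ ξ) = b3
  linear_combination (A₁ ξ * A₂ ξ * b3 - b1 * b2 * A₃ ξ) ^ 2 * ((ε : ℂ) ^ 2 * I_sq - hε')
end
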